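/- arXiv:1707.01016 — 7 statements merged into one kernel-verified Lean document; each statement's English description precedes it below -/
import Mathlib

section
/- Let H and K be complex Hilbert spaces with Hilbert (orthonormal) bases (e_k)_{k∈ι} of H and (f_k)_{k∈ι} of K indexed by the same set ι. Let A be a unitary operator on H, B a unitary operator on K, and α : ι → [0,∞) a bounded function with r = sup_k α_k. Assume α_j ⟨A e_j, e_i⟩ = α_i ⟨B f_i, f_j⟩ for all i, j ∈ ι. Then for every i with α_i = r one has ⟨A e_j, e_i⟩ = 0 for all j with α_j < r; consequently A* e_i lies in the closed linear span of {e_k : α_k = r}, and if moreover A^m = I for some integer m ≥ 1, then the closed linear span of {e_k : α_k = r} is invariant under both A and A*. -/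
noncomputable section

open ContinuousLinearMap

theorem parseval_norm_sq {H : Type*} [NormedAddCommGroup H] [InnerProductSpace ℂ H]
    {ι : Type*} (e : HilbertBasis ι ℂ H) (x : H) :
    HasSum (fun j => ‖inner (𝕜 := ℂ) (e j) x‖ ^ 2) (‖x‖ ^ 2) := by
  have h := e.hasSum_inner_mul_inner x x
  have h2 := Complex.hasSum_re h
  have e1 : (inner ℂ x x : ℂ).re = ‖x‖ ^ 2 := by
    rw [inner_self_eq_norm_sq_to_K]; norm_cast
  rw [e1] at h2
  refine h2.congr_fun ?_ |> id
  intro j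
  rw [← inner_conj_symm x (e j), RCLike.conj_mul]
  norm_cast

theorem norm_of_isometry {H : Type*} [NormedAddCommGroup H] [InnerProductSpace ℂ H]
    [CompleteSpace H] (A : H →L[ℂ] H) (h : adjoint A ∘L A = 1) (x : H) : ‖A x‖ = ‖x‖ :=
  (ContinuousLinearMap.norm_map_iff_adjoint_comp_self A).2 h x

/-- Slofstra–Schmidt-decomposition lemma: if unitaries `A` on `H` and `B` on `K`
satisfy `α_j ⟨A e_j, e_i⟩ = α_i ⟨B f_i, f_j⟩` for Hilbert bases `(e_k)`, `(f_k)` and a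
bounded nonnegative weight `α` with supremum `r`, then for `i` with `α_i = r` the matrix
entries `⟨A e_j, e_i⟩` vanish when `α_j < r`; hence `A* e_i` lies in the closed span of
`{e_k : α_k = r}`, and if `A^m = 1` that closed span is invariant under `A` and `A*`. -/
theorem top_schmidt_block_reduces
    {H K : Type*} [NormedAddCommGroup H] [InnerProductSpace ℂ H] [CompleteSpace H]
    [NormedAddCommGroup K] [InnerProductSpace ℂ K] [CompleteSpace K]
    {ι : Type*} [Nonempty ι]
    (e : HilbertBasis ι ℂ H) (f : HilbertBasis ι ℂ K)
    (A : H →L[ℂ] H) (B : K →L[ℂ] K)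
    (hA : A ∘L adjoint A = 1 ∧ adjoint A ∘L A = 1)
    (hB : B ∘L adjoint B = 1 ∧ adjoint B ∘L B = 1)
    (α : ι → ℝ) (hα0 : ∀ k, 0 ≤ α k) (hbd : BddAbove (Set.range α))
    (hrel : ∀ i j, (α j : ℂ) * inner (𝕜 := ℂ) (e i) (A (e j))
      = (α i : ℂ) * inner (𝕜 := ℂ) (f j) (B (f i))) :
    (∀ i, α i = (⨆ k, α k) → ∀ j, α j < (⨆ k, α k) →
        inner (𝕜 := ℂ) (e i) (A (e j)) = 0) ∧
    (∀ i, α i = (⨆ k, α k) →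
        adjoint A (e i) ∈
          (Submodule.span ℂ (e '' {k | α k = (⨆ k, α k)})).topologicalClosure) ∧
    (∀ m : ℕ, 1 ≤ m → A ^ m = 1 →
        ∀ x ∈ (Submodule.span ℂ (e '' {k | α k = (⨆ k, α k)})).topologicalClosure,
          A x ∈ (Submodule.span ℂ (e '' {k | α k = (⨆ k, α k)})).topologicalClosure ∧
          adjoint A x ∈
            (Submodule.span ℂ (e '' {k | α k = (⨆ k, α k)})).topologicalClosure) := by
  have key : ∀ i, α i = (⨆ k, α k) → ∀ j, α j < (⨆ k, α k) →
      inner (𝕜 := ℂ) (e i) (A (e j)) = 0 := by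
    intro i hi j hj
    have hr : 0 < α i := by rw [hi]; exact lt_of_le_of_lt (hα0 j) hj
    have h1 : HasSum (fun k => ‖inner (𝕜 := ℂ) (e i) (A (e k))‖ ^ 2) 1 := by
      have h := parseval_norm_sq e (adjoint A (e i))
      rw [norm_of_isometry (adjoint A) (by rw [adjoint_adjoint]; exact hA.1),
        e.orthonormal.1 i] at h
      simpa [adjoint_inner_right, norm_inner_symm] using h
    have h2 : HasSum (fun k => ‖inner (𝕜 := ℂ) (f k) (B (f i))‖ ^ 2) 1 := by
      have h := parseval_norm_sq f (B (f i))
      rw [norm_of_isometry B hB.2, f.orthonormal.1 i] at h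
      simpa using h
    have hn : ∀ k, α k * ‖inner (𝕜 := ℂ) (e i) (A (e k))‖
        = α i * ‖inner (𝕜 := ℂ) (f k) (B (f i))‖ := by
      intro k
      have h := congrArg norm (hrel i k)
      simpa [abs_of_nonneg (hα0 _)] using h
    have hle : ∀ k, ‖inner (𝕜 := ℂ) (f k) (B (f i))‖
        ≤ ‖inner (𝕜 := ℂ) (e i) (A (e k))‖ := by
      intro k
      have hk : α k ≤ α i := by rw [hi]; exact le_ciSup hbd k
      refine le_of_mul_le_mul_left ?_ hr
      rw [← hn k]
      exact mul_le_mul_of_nonneg_right hk (norm_nonneg _)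
    by_contra hne
    have hpos : 0 < ‖inner (𝕜 := ℂ) (e i) (A (e j))‖ := norm_pos_iff.2 hne
    have hlt : ‖inner (𝕜 := ℂ) (f j) (B (f i))‖ < ‖inner (𝕜 := ℂ) (e i) (A (e j))‖ := by
      refine lt_of_mul_lt_mul_left ?_ hr.le
      rw [← hn j]
      exact mul_lt_mul_of_pos_right (hi ▸ hj) hpos
    exact lt_irrefl _ (hasSum_lt (i := j)
      (fun k => pow_le_pow_left₀ (norm_nonneg _) (hle k) 2)
      (pow_lt_pow_left₀ hlt (norm_nonneg _) two_ne_zero) h2 h1)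
  have key2 : ∀ i, α i = (⨆ k, α k) →
      adjoint A (e i) ∈
        (Submodule.span ℂ (e '' {k | α k = (⨆ k, α k)})).topologicalClosure := by
    intro i hi
    have hs := e.hasSum_repr (adjoint A (e i))
    refine (Submodule.isClosed_topologicalClosure _).mem_of_tendsto hs
      (Filter.Eventually.of_forall fun s => Submodule.sum_mem _ fun j _ => ?_)
    by_cases hj : α j = ⨆ k, α k
    · exact Submodule.smul_mem _ _ (Submodule.le_topologicalClosure _
        (Submodule.subset_span ⟨j, hj, rfl⟩))
    · have h0 := key i hi j (lt_of_le_of_ne (le_ciSup hbd j) hj)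
      have : e.repr (adjoint A (e i)) j = 0 := by
        rw [e.repr_apply_apply, adjoint_inner_right, ← inner_conj_symm, h0, map_zero]
      rw [this, zero_smul]
      exact Submodule.zero_mem _
  refine ⟨key, key2, ?_⟩
  intro m hm hAm
  have hadj : ∀ x ∈ (Submodule.span ℂ (e '' {k | α k = (⨆ k, α k)})).topologicalClosure,
      adjoint A x ∈
        (Submodule.span ℂ (e '' {k | α k = (⨆ k, α k)})).topologicalClosure := by
    have hle : (Submodule.span ℂ (e '' {k | α k = (⨆ k, α k)})).topologicalClosure ≤
        (Submodule.span ℂ (e '' {k | α k = (⨆ k, α k)})).topologicalClosure.comap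
          (adjoint A : H →L[ℂ] H).toLinearMap := by
      refine Submodule.topologicalClosure_minimal _ (Submodule.span_le.2 ?_) ?_
      · rintro _ ⟨k, hk, rfl⟩
        exact key2 k hk
      · exact (Submodule.isClosed_topologicalClosure _).preimage (adjoint A).continuous
    exact fun x hx => hle hx
  have hpow : ∀ n : ℕ,
      ∀ x ∈ (Submodule.span ℂ (e '' {k | α k = (⨆ k, α k)})).topologicalClosure,
      ((adjoint A) ^ n) x ∈
        (Submodule.span ℂ (e '' {k | α k = (⨆ k, α k)})).topologicalClosure := by
    intro n
    induction n with
    | zero => intro x hx; simpa using hx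
    | succ n ih =>
      intro x hx
      rw [pow_succ]
      exact ih _ (hadj x hx)
  have hAeq : A = (adjoint A) ^ (m - 1) := by
    obtain ⟨n, rfl⟩ : ∃ n, m = n + 1 := ⟨m - 1, by omega⟩
    have h1 : A * adjoint A = 1 := hA.1
    have h2 : (adjoint A) ^ (n + 1) = 1 := by
      rw [← star_eq_adjoint, ← star_pow, hAm, star_one]
    calc A = A * (adjoint A) ^ (n + 1) := by rw [h2, mul_one]
      _ = (adjoint A) ^ n := by rw [pow_succ', ← mul_assoc, h1, one_mul]
  intro x hx
  refine ⟨?_, hadj x hx⟩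
  rw [hAeq]
  exact hpow _ x hx
end
end

section
/- Fix a linear system (A, b) as in the context. Let 𝒜 be a unital C*-algebra with a tracial state τ, and let e_{i,x} ∈ 𝒜 for i ∈ {1,…,m} and x ∈ {±1}^n be projections with Σ_{x ∈ {±1}^n} e_{i,x} = 1 for every i, such that τ(e_{i,x} e_{j,y}) = 0 whenever x ∉ S_i, or y ∉ S_j, or there exists k ∈ V_i ∩ V_j with x_k ≠ y_k. Then for all i, j ∈ {1,…,m} and every k ∈ V_i ∩ V_j, setting c = Σ_{x∈S_i} x_k e_{i,x} − Σ_{y∈S_j} y_k e_{j,y}, one has τ(c* c) = 0. -/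
open scoped ComplexOrder

noncomputable section

/-- `V_i`: the set of variables occurring in the `i`-th equation of the linear
system `Ax = b` over `ℤ/2`. -/
def eqnVars {m n : ℕ} (A : Matrix (Fin m) (Fin n) (ZMod 2)) (i : Fin m) : Finset (Fin n) :=
  Finset.univ.filter (fun j => A i j ≠ 0)

/-- `S_i`: the solutions (written multiplicatively, with values in `{±1} ≅ (ℤˣ)`) of
the `i`-th equation `∏_{j ∈ V_i} x_j = (−1)^{b_i}`, normalised to be `1` outside `V_i`. -/
def eqnSols {m n : ℕ} (A : Matrix (Fin m) (Fin n) (ZMod 2)) (b : Fin m → ZMod 2)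
    (i : Fin m) : Finset (Fin n → Units ℤ) :=
  Finset.univ.filter
    (fun x => (∏ j ∈ eqnVars A i, x j) = (-1 : Units ℤ) ^ (b i).val ∧
      ∀ j, A i j = 0 → x j = 1)

/-- Part of Theorem 4.4 of the paper: given a tracial state `τ` and projections
`e_{i,x}` summing to `1` in each row, with `τ(e_{i,x} e_{j,y}) = 0` on all losing pairs
of the game `synBCS(A,b)`, the element
`c = Σ_{x ∈ S_i} x_k e_{i,x} − Σ_{y ∈ S_j} y_k e_{j,y}` satisfies `τ(c* c) = 0`
for every `k ∈ V_i ∩ V_j`. -/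
theorem trace_of_consistency_defect_eq_zero
    {m n : ℕ} (A : Matrix (Fin m) (Fin n) (ZMod 2)) (b : Fin m → ZMod 2)
    {𝒜 : Type*} [NormedRing 𝒜] [StarRing 𝒜] [CStarRing 𝒜] [NormedAlgebra ℂ 𝒜]
    [CompleteSpace 𝒜]
    (τ : 𝒜 →ₗ[ℂ] ℂ) (hτ1 : τ 1 = 1)
    (hτpos : ∀ a : 𝒜, 0 ≤ τ (star a * a))
    (hτtr : ∀ a c : 𝒜, τ (a * c) = τ (c * a))
    (e : Fin m → (Fin n → Units ℤ) → 𝒜)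
    (hproj : ∀ i x, star (e i x) = e i x ∧ e i x * e i x = e i x)
    (hsum : ∀ i, (∑ x : Fin n → Units ℤ, e i x) = 1)
    (hlose : ∀ i j x y,
      (x ∉ eqnSols A b i ∨ y ∉ eqnSols A b j ∨
        ∃ k, A i k ≠ 0 ∧ A j k ≠ 0 ∧ x k ≠ y k) →
      τ (e i x * e j y) = 0) :
    ∀ i j k, A i k ≠ 0 → A j k ≠ 0 →
      ∀ c : 𝒜,
        c = (∑ x ∈ eqnSols A b i, (((x k : ℤ) : ℂ)) • e i x)
            - (∑ y ∈ eqnSols A b j, (((y k : ℤ) : ℂ)) • e j y) →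
        τ (star c * c) = 0 := by
  intro i j k hi hj c hc
  have key : ∀ i j, A i k ≠ 0 → A j k ≠ 0 →
      τ ((∑ x ∈ eqnSols A b i, (((x k : ℤ) : ℂ)) • e i x) *
        (∑ y ∈ eqnSols A b j, (((y k : ℤ) : ℂ)) • e j y)) = 1 := by
    intro i j hi hj
    have hterm : ∀ x y, τ ((((x k : ℤ) : ℂ) • e i x) * (((y k : ℤ) : ℂ) • e j y))
        = τ (e i x * e j y) := by
      intro x y
      rw [smul_mul_smul_comm, map_smul]
      by_cases h : x k = y k
      · have h2 : ((x k : ℤ) : ℂ) * ((y k : ℤ) : ℂ) = 1 := by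
          rw [h]
          rcases Int.units_eq_one_or (y k) with h3 | h3 <;> simp [h3]
        rw [h2, one_smul]
      · rw [hlose i j x y (Or.inr (Or.inr ⟨k, hi, hj, h⟩)), smul_zero]
    rw [Finset.sum_mul_sum, map_sum]
    simp only [map_sum, hterm]
    have h1 : τ ((∑ x, e i x) * (∑ y, e j y)) = 1 := by
      rw [hsum, hsum, one_mul, hτ1]
    rw [Finset.sum_mul_sum, map_sum] at h1
    simp only [map_sum] at h1
    rw [← h1]
    trans ∑ x ∈ eqnSols A b i, ∑ y, τ (e i x * e j y)
    · refine Finset.sum_congr rfl fun x _ => ?_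
      exact Finset.sum_subset (Finset.subset_univ _) fun y _ hy =>
        hlose i j x y (Or.inr (Or.inl hy))
    · exact Finset.sum_subset (Finset.subset_univ _) fun x _ hx =>
        Finset.sum_eq_zero fun y _ => hlose i j x y (Or.inl hx)
  have hstar : ∀ i, star (∑ x ∈ eqnSols A b i, (((x k : ℤ) : ℂ)) • e i x)
      = ∑ x ∈ eqnSols A b i, (((x k : ℤ) : ℂ)) • e i x := by
    intro i
    rw [star_sum]
    refine Finset.sum_congr rfl fun x _ => ?_
    rw [Int.cast_smul_eq_zsmul, star_zsmul, (hproj i x).1]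
  rw [hc, star_sub, hstar, hstar, sub_mul, mul_sub, mul_sub, map_sub, map_sub, map_sub,
    key i i hi hi, key i j hi hj, key j i hj hi, key j j hj hj]
  simp
end
end

section
/- Fix an m × n linear system A over ℤ/2 and b ∈ (ℤ/2)^m; let S_i¹ and S_i⁰ denote the sets S_i for the systems Ax = b and Ax = 0 respectively, and let G_{A,b} and G_{A,0} be the associated graphs. Let 𝒜 be a unital complex *-algebra containing projections e_{i,x} for i ∈ {1,…,m} and x ∈ {±1}^n such that e_{i,x} = 0 whenever x ∉ S_i¹, Σ_{x ∈ {±1}^n} e_{i,x} = 1 for each i, and e_{i,x} e_{j,y} = 0 whenever there is k ∈ V_i ∩ V_j with x_k ≠ y_k. For vertices (i,x) of G_{A,b} and (j,y) of G_{A,0}, define q_{(i,x),(j,y)} = e_{i, xy} if i = j (where xy ∈ {±1}^n is the pointwise product) and q_{(i,x),(j,y)} = 0 if i ≠ j. Then: each q_{(i,x),(j,y)} is a projection; for every vertex (i,x) of G_{A,b}, Σ over vertices (j,y) of G_{A,0} of q_{(i,x),(j,y)} equals 1; for every vertex (j,y) of G_{A,0}, Σ over vertices (i,x) of G_{A,b}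 of q_{(i,x),(j,y)} equals 1; and q_{(i,x),(j,y)} q_{(i',x'),(j',y')} = 0 whenever rel((i,x),(i',x')) in G_{A,b} differs from rel((j,y),(j',y')) in G_{A,0}. -/
noncomputable section

/-- The vertex set of the graph `G_{A,b}`: pairs `(i, x)` with `x ∈ S_i`. -/
def VertexAb {m n : ℕ} (A : Matrix (Fin m) (Fin n) (ZMod 2)) (b : Fin m → ZMod 2) : Type :=
  {v : Fin m × (Fin n → Units ℤ) // v.2 ∈ eqnSols A b v.1}

/-- Adjacency in `G_{A,b}`: distinct vertices carrying inconsistent solutions. -/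
def adjAb {m n : ℕ} (A : Matrix (Fin m) (Fin n) (ZMod 2)) (b : Fin m → ZMod 2)
    (v w : VertexAb A b) : Prop :=
  v ≠ w ∧ ∃ k, A v.1.1 k ≠ 0 ∧ A w.1.1 k ≠ 0 ∧ v.1.2 k ≠ w.1.2 k

instance {m n : ℕ} (A : Matrix (Fin m) (Fin n) (ZMod 2)) (b : Fin m → ZMod 2) :
    Fintype (VertexAb A b) :=
  Subtype.fintype _

/-- `rel(v,v') = rel(w,w')` for vertices `v, v'` of `G_{A,b}` and `w, w'` of `G_{A,0}`. -/
def relSameAb {m n : ℕ} (A : Matrix (Fin m) (Fin n) (ZMod 2)) (b : Fin m → ZMod 2)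
    (v v' : VertexAb A b) (w w' : VertexAb A 0) : Prop :=
  (v = v' ∧ w = w') ∨ (adjAb A b v v' ∧ adjAb A 0 w w') ∨
    (v ≠ v' ∧ ¬ adjAb A b v v' ∧ w ≠ w' ∧ ¬ adjAb A 0 w w')

theorem mem_eqnSols_iff {m n : ℕ} (A : Matrix (Fin m) (Fin n) (ZMod 2)) (b : Fin m → ZMod 2)
    (i : Fin m) (x : Fin n → Units ℤ) : x ∈ eqnSols A b i ↔
      ((∏ j ∈ eqnVars A i, x j) = (-1 : Units ℤ) ^ (b i).val ∧ ∀ j, A i j = 0 → x j = 1) := by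
  simp [eqnSols]

theorem eqnSols_mul_self {m n : ℕ} (A : Matrix (Fin m) (Fin n) (ZMod 2)) (b : Fin m → ZMod 2)
    (i : Fin m) (x y : Fin n → Units ℤ) (hx : x ∈ eqnSols A b i) (hy : y ∈ eqnSols A b i) :
    x * y ∈ eqnSols A 0 i := by
  rw [mem_eqnSols_iff] at *
  refine ⟨?_, fun j hj => by simp [hx.2 j hj, hy.2 j hj]⟩
  simp only [Pi.mul_apply, Finset.prod_mul_distrib, hx.1, hy.1]
  simp [Int.units_mul_self]

theorem eqnSols_mul_zero {m n : ℕ} (A : Matrix (Fin m) (Fin n) (ZMod 2)) (b : Fin m → ZMod 2)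
    (i : Fin m) (x y : Fin n → Units ℤ) (hx : x ∈ eqnSols A b i) (hy : y ∈ eqnSols A 0 i) :
    x * y ∈ eqnSols A b i := by
  rw [mem_eqnSols_iff] at *
  refine ⟨?_, fun j hj => by simp [hx.2 j hj, hy.2 j hj]⟩
  simp only [Pi.mul_apply, Finset.prod_mul_distrib, hx.1, hy.1]
  simp

theorem pm_mul_self {n : ℕ} (x : Fin n → Units ℤ) : x * x = 1 := by
  ext k; simp [Int.units_mul_self]

theorem vertex_eq_iff {m n : ℕ} (A : Matrix (Fin m) (Fin n) (ZMod 2)) (b : Fin m → ZMod 2)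
    (v w : VertexAb A b) : v = w ↔ (v.1.1 = w.1.1 ∧ ∀ k, A v.1.1 k ≠ 0 → A w.1.1 k ≠ 0 →
      v.1.2 k = w.1.2 k) := by
  constructor
  · rintro rfl; simp
  · obtain ⟨⟨i, x⟩, hx⟩ := v
    obtain ⟨⟨j, y⟩, hy⟩ := w
    rintro ⟨h1, h2⟩
    dsimp only at *
    subst h1
    have : x = y := by
      funext k
      rw [mem_eqnSols_iff] at hx hy
      by_cases hk : A i k = 0
      · exact (hx.2 k hk).trans (hy.2 k hk).symm
      · exact h2 k hk hk
    subst this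
    rfl

/-- Theorem 5.4, (1) ⇒ (2) of the paper (the algebraic part): from projections
`e_{i,x}` giving a perfect strategy datum for `synBCS(A,b)`, the elements
`q_{(i,x),(j,y)} = δ_{i,j} e_{i,xy}` form magic-permutation data for the
`(G_{A,b}, G_{A,0})`-isomorphism game. -/
theorem isomorphism_game_projections_of_synBCS_projections
    {m n : ℕ} (A : Matrix (Fin m) (Fin n) (ZMod 2)) (b : Fin m → ZMod 2)
    {𝒜 : Type*} [Ring 𝒜] [Algebra ℂ 𝒜] [StarRing 𝒜]
    (e : Fin m → (Fin n → Units ℤ) → 𝒜)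
    (hproj : ∀ i x, star (e i x) = e i x ∧ e i x * e i x = e i x)
    (hvanish : ∀ i x, x ∉ eqnSols A b i → e i x = 0)
    (hsum : ∀ i, (∑ x : Fin n → Units ℤ, e i x) = 1)
    (horth : ∀ i j x y, (∃ k, A i k ≠ 0 ∧ A j k ≠ 0 ∧ x k ≠ y k) → e i x * e j y = 0)
    (q : VertexAb A b → VertexAb A 0 → 𝒜)
    (hq : ∀ v w, q v w = if v.1.1 = w.1.1 then e v.1.1 (v.1.2 * w.1.2) else 0) :
    (∀ v w, star (q v w) = q v w ∧ q v w * q v w = q v w) ∧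
    (∀ v : VertexAb A b, (∑ w : VertexAb A 0, q v w) = 1) ∧
    (∀ w : VertexAb A 0, (∑ v : VertexAb A b, q v w) = 1) ∧
    (∀ v v' w w', ¬ relSameAb A b v v' w w' → q v w * q v' w' = 0) := by
  have key : ∀ v v' w w', q v w * q v' w' ≠ 0 → relSameAb A b v v' w w' := by
    intro v v' w w' hne
    have h1 : v.1.1 = w.1.1 := by
      by_contra h; apply hne; rw [hq v w, if_neg h, zero_mul]
    have h2 : v'.1.1 = w'.1.1 := by
      by_contra h; apply hne; rw [hq v' w', if_neg h, mul_zero]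
    rw [hq v w, hq v' w', if_pos h1, if_pos h2] at hne
    have h3 : ∀ k, A v.1.1 k ≠ 0 → A v'.1.1 k ≠ 0 →
        v.1.2 k * w.1.2 k = v'.1.2 k * w'.1.2 k := by
      intro k hk hk'
      by_contra h
      exact hne (horth _ _ _ _ ⟨k, hk, hk', h⟩)
    have h4 : ∀ k, A v.1.1 k ≠ 0 → A v'.1.1 k ≠ 0 →
        (v.1.2 k = v'.1.2 k ↔ w.1.2 k = w'.1.2 k) := by
      intro k hk hk'
      have h := h3 k hk hk'
      constructor
      · intro h'; rw [h'] at h; exact mul_left_cancel h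
      · intro h'; rw [h'] at h; exact mul_right_cancel h
    have heq : v = v' ↔ w = w' := by
      rw [vertex_eq_iff, vertex_eq_iff, ← h1, ← h2]
      exact and_congr_right fun _ => forall_congr' fun k =>
        ⟨fun h a c => (h4 k a c).1 (h a c), fun h a c => (h4 k a c).2 (h a c)⟩
    have hadj : adjAb A b v v' ↔ adjAb A 0 w w' := by
      unfold adjAb
      rw [← h1, ← h2]
      refine and_congr (not_congr heq) (exists_congr fun k => ?_)
      exact and_congr_right fun a => and_congr_right fun c => not_congr (h4 k a c)
    unfold relSameAb
    tauto
  refine ⟨?_, ?_, ?_, ?_⟩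
  · intro v w
    rw [hq]
    split_ifs
    · exact hproj _ _
    · simp
  · intro v
    rw [← hsum v.1.1]
    have hfst : ∀ w, q v w ≠ 0 → v.1.1 = w.1.1 := by
      intro w h; by_contra h'; exact h (by rw [hq, if_neg h'])
    refine Finset.sum_bij_ne_zero (fun w _ _ => v.1.2 * w.1.2) (fun _ _ _ => Finset.mem_univ _)
      ?_ ?_ ?_
    · intro w _ hw w' _ hw' h
      exact Subtype.ext (Prod.ext ((hfst w hw).symm.trans (hfst w' hw')) (mul_left_cancel h))
    · intro x _ hx
      have hxS : x ∈ eqnSols A b v.1.1 := by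
        by_contra h; exact hx (hvanish _ _ h)
      have hm : v.1.2 * (v.1.2 * x) = x := by rw [← mul_assoc, pm_mul_self, one_mul]
      refine ⟨⟨(v.1.1, v.1.2 * x), eqnSols_mul_self A b _ _ _ v.2 hxS⟩, Finset.mem_univ _, ?_, hm⟩
      intro h0
      refine hx ((congrArg _ hm.symm).trans (Eq.trans ?_ h0))
      exact ((hq _ _).trans (if_pos rfl)).symm
    · intro w _ hw
      rw [hq, if_pos (hfst w hw)]
  · intro w
    rw [← hsum w.1.1]
    have hfst : ∀ v, q v w ≠ 0 → v.1.1 = w.1.1 := by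
      intro v h; by_contra h'; exact h (by rw [hq, if_neg h'])
    refine Finset.sum_bij_ne_zero (fun v _ _ => v.1.2 * w.1.2) (fun _ _ _ => Finset.mem_univ _)
      ?_ ?_ ?_
    · intro v _ hv v' _ hv' h
      exact Subtype.ext (Prod.ext ((hfst v hv).trans (hfst v' hv').symm) (mul_right_cancel h))
    · intro x _ hx
      have hxS : x ∈ eqnSols A b w.1.1 := by
        by_contra h; exact hx (hvanish _ _ h)
      have hm : (x * w.1.2) * w.1.2 = x := by rw [mul_assoc, pm_mul_self, mul_one]
      refine ⟨⟨(w.1.1, x * w.1.2), eqnSols_mul_zero A b _ _ _ hxS w.2⟩, Finset.mem_univ _, ?_, hm⟩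
      intro h0
      refine hx ((congrArg _ hm.symm).trans (Eq.trans ?_ h0))
      exact ((hq _ _).trans (if_pos rfl)).symm
    · intro v _ hv
      rw [hq, if_pos (hfst v hv), hfst v hv]
  · intro v v' w w' h
    by_contra hne
    exact h (key v v' w w' hne)
end
end

section
/- Let G and H be finite graphs, each with nonempty vertex set. If G ≅_q H, then α_q(G) = α_q(H). -/
open Matrix

noncomputable section

/-- The set of quantum correlations with input set `I` and output set `O`:
`p x y a b` is the probability of outputs `(a,b)` on inputs `(x,y)`, realised by
finite-dimensional PVMs `E`, `F` and a unit vector `ψ` in the tensor product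
(Kronecker) Hilbert space. -/
def QCorr (I O : Type) [Fintype I] [Fintype O] : Set (I → I → O → O → ℝ) :=
  {p | ∃ dA dB : ℕ, 0 < dA ∧ 0 < dB ∧
    ∃ (E : I → O → Matrix (Fin dA) (Fin dA) ℂ)
      (F : I → O → Matrix (Fin dB) (Fin dB) ℂ)
      (ψ : Fin dA × Fin dB → ℂ),
      (∀ x a, (E x a).IsHermitian ∧ E x a * E x a = E x a) ∧
      (∀ x, ∑ a, E x a = 1) ∧
      (∀ y b, (F y b).IsHermitian ∧ F y b * F y b = F y b) ∧
      (∀ y, ∑ b, F y b = 1) ∧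
      star ψ ⬝ᵥ ψ = 1 ∧
      (∀ x y a b, (p x y a b : ℂ) =
        star ψ ⬝ᵥ (Matrix.kroneckerMap (· * ·) (E x a) (F y b)).mulVec ψ) }

/-- A game (described by its losing-tuple predicate `lose`: `lose x y a b` means
`λ(x,y,a,b) = 0`) has a perfect q-strategy. -/
def PerfectQ {I O : Type} [Fintype I] [Fintype O]
    (lose : I → I → O → O → Prop) : Prop :=
  ∃ p ∈ QCorr I O, ∀ x y a b, lose x y a b → p x y a b = 0

/-- A game has a perfect qa-strategy: a correlation in the closure of `QCorr`
vanishing on losing tuples. -/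
def PerfectQA {I O : Type} [Fintype I] [Fintype O]
    (lose : I → I → O → O → Prop) : Prop :=
  ∃ p ∈ closure (QCorr I O), ∀ x y a b, lose x y a b → p x y a b = 0

/-- The losing tuples of the independence game for a graph `G` with `c` inputs:
on inputs `(i,j)` and outputs `(v,w)`, the players lose iff (`i = j` and `v ≠ w`) or
(`i ≠ j` and (`v = w` or `v ∼ w`)). -/
def indepLose {V : Type} (G : SimpleGraph V) (c : ℕ) :
    Fin c → Fin c → V → V → Prop :=
  fun i j v w => (i = j ∧ v ≠ w) ∨ (i ≠ j ∧ (v = w ∨ G.Adj v w))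

/-- The quantum independence number `α_q(G)`: the largest `c` for which the
independence game has a perfect q-strategy. -/
def alphaQ {V : Type} [Fintype V] (G : SimpleGraph V) : ℕ :=
  sSup {c : ℕ | PerfectQ (indepLose G c)}

/-- The quantum approximate independence number `α_qa(G)`. -/
def alphaQA {V : Type} [Fintype V] (G : SimpleGraph V) : ℕ :=
  sSup {c : ℕ | PerfectQA (indepLose G c)}

/-- The losing tuples of the `d`-coloring game for a graph `G`. -/
def colorLose {V : Type} (G : SimpleGraph V) (d : ℕ) :
    V → V → Fin d → Fin d → Prop :=
  fun v w i j => (v = w ∧ i ≠ j) ∨ (G.Adj v w ∧ i = j)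

/-- The quantum chromatic number `χ_q(G)`: the least `d` for which the `d`-coloring
game has a perfect q-strategy. -/
def chiQ {V : Type} [Fintype V] (G : SimpleGraph V) : ℕ :=
  sInf {d : ℕ | PerfectQ (colorLose G d)}

/-- The quantum approximate chromatic number `χ_qa(G)`. -/
def chiQA {V : Type} [Fintype V] (G : SimpleGraph V) : ℕ :=
  sInf {d : ℕ | PerfectQA (colorLose G d)}

/-- `rel(g,g') = rel(h,h')` for vertices `g, g'` of `G` and `h, h'` of `H`. -/
def relSame {VG VH : Type} (G : SimpleGraph VG) (H : SimpleGraph VH)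
    (g g' : VG) (h h' : VH) : Prop :=
  (g = g' ∧ h = h') ∨ (G.Adj g g' ∧ H.Adj h h') ∨
    (g ≠ g' ∧ ¬ G.Adj g g' ∧ h ≠ h' ∧ ¬ H.Adj h h')

/-- Pair an input and an output of the `(G,H)`-isomorphism game into an element of
`V(G) × V(H)`, provided the output lies in the opposite graph from the input
(otherwise `none`). -/
def pairIO {VG VH : Type} : (VG ⊕ VH) → (VG ⊕ VH) → Option (VG × VH)
  | Sum.inl g, Sum.inr h => some (g, h)
  | Sum.inr h, Sum.inl g => some (g, h)
  | _, _ => none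

/-- The losing tuples of the `(G,H)`-isomorphism game: the players win iff each
output is in the opposite graph from the corresponding input and, for the resulting
pairs `(g_A, h_A)`, `(g_B, h_B)`, one has `rel(g_A,g_B) = rel(h_A,h_B)`. -/
def isoLose {VG VH : Type} (G : SimpleGraph VG) (H : SimpleGraph VH) :
    (VG ⊕ VH) → (VG ⊕ VH) → (VG ⊕ VH) → (VG ⊕ VH) → Prop :=
  fun xA xB aA aB =>
    ¬ ∃ (gA : VG) (hA : VH) (gB : VG) (hB : VH),
        pairIO xA aA = some (gA, hA) ∧ pairIO xB aB = some (gB, hB) ∧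
        relSame G H gA gB hA hB

/-- `G ≅_q H`: the `(G,H)`-isomorphism game has a perfect q-strategy. -/
def QIso {VG VH : Type} [Fintype VG] [Fintype VH]
    (G : SimpleGraph VG) (H : SimpleGraph VH) : Prop :=
  PerfectQ (isoLose G H)

/-- `G ≅_qa H`: the `(G,H)`-isomorphism game has a perfect qa-strategy. -/
def QAIso {VG VH : Type} [Fintype VG] [Fintype VH]
    (G : SimpleGraph VG) (H : SimpleGraph VH) : Prop :=
  PerfectQA (isoLose G H)

theorem dotProduct_kron_aux {S T : Type} [Fintype S] [Fintype T]
    (M : Matrix S S ℂ) (N : Matrix T T ℂ) (u : S → ℂ) (v : T → ℂ) :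
    star (fun z : S × T => u z.1 * v z.2) ⬝ᵥ
      (Matrix.kroneckerMap (· * ·) M N).mulVec (fun z : S × T => u z.1 * v z.2) =
    (star u ⬝ᵥ M.mulVec u) * (star v ⬝ᵥ N.mulVec v) := by
  have h : (Matrix.kroneckerMap (· * ·) M N).mulVec (fun z : S × T => u z.1 * v z.2) =
      fun z : S × T => M.mulVec u z.1 * N.mulVec v z.2 := by
    funext z
    simp only [Matrix.mulVec, dotProduct, Fintype.sum_prod_type, Matrix.kroneckerMap_apply,
      Finset.sum_mul_sum]
    refine Finset.sum_congr rfl fun i _ => Finset.sum_congr rfl fun j _ => ?_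
    ring
  rw [h]
  simp only [dotProduct, Fintype.sum_prod_type, Finset.sum_mul_sum, Pi.star_apply, star_mul']
  refine Finset.sum_congr rfl fun i _ => Finset.sum_congr rfl fun j _ => ?_
  ring

/-- Realisations on arbitrary finite index types give quantum correlations. -/
theorem QCorr_mk {I O A B : Type} [Fintype I] [Fintype O] [Fintype A] [Fintype B]
    [DecidableEq A] [DecidableEq B] [Nonempty A] [Nonempty B]
    (p : I → I → O → O → ℝ)
    (E : I → O → Matrix A A ℂ) (F : I → O → Matrix B B ℂ) (ψ : A × B → ℂ)
    (hE : ∀ x a, (E x a).IsHermitian ∧ E x a * E x a = E x a) (hE1 : ∀ x, ∑ a, E x a = 1)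
    (hF : ∀ x a, (F x a).IsHermitian ∧ F x a * F x a = F x a) (hF1 : ∀ x, ∑ a, F x a = 1)
    (hψ : star ψ ⬝ᵥ ψ = 1)
    (hp : ∀ x y a b, (p x y a b : ℂ) =
        star ψ ⬝ᵥ (Matrix.kroneckerMap (· * ·) (E x a) (F y b)).mulVec ψ) :
    p ∈ QCorr I O := by
  let α := (Fintype.equivFin A).symm
  let β := (Fintype.equivFin B).symm
  let γ := Equiv.prodCongr α β
  refine ⟨Fintype.card A, Fintype.card B, Fintype.card_pos, Fintype.card_pos,
    fun x a => (E x a).submatrix α α, fun x a => (F x a).submatrix β β, ψ ∘ γ,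
    fun x a => ⟨(hE x a).1.submatrix α, ?_⟩, fun x => ?_,
    fun x a => ⟨(hF x a).1.submatrix β, ?_⟩, fun x => ?_, ?_, fun x y a b => ?_⟩
  · rw [Matrix.submatrix_mul_equiv, (hE x a).2]
  · have := congrArg (fun M : Matrix A A ℂ => M.submatrix α α) (hE1 x)
    simp only [Matrix.submatrix_one_equiv] at this
    rw [← this]
    ext i j
    simp [Matrix.sum_apply]
  · rw [Matrix.submatrix_mul_equiv, (hF x a).2]
  · have := congrArg (fun M : Matrix B B ℂ => M.submatrix β β) (hF1 x)
    simp only [Matrix.submatrix_one_equiv] at this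
    rw [← this]
    ext i j
    simp [Matrix.sum_apply]
  · rw [← hψ]
    exact Equiv.sum_comp γ (fun z => star ψ z * ψ z)
  · rw [hp]
    have h1 : Matrix.kroneckerMap (· * ·) ((E x a).submatrix α α) ((F y b).submatrix β β) =
        (Matrix.kroneckerMap (· * ·) (E x a) (F y b)).submatrix γ γ := by
      ext i j
      rfl
    rw [h1, Matrix.submatrix_mulVec_equiv, Function.comp_assoc, Equiv.self_comp_symm,
      Function.comp_id]
    exact (Equiv.sum_comp γ (fun z => star ψ z *
      ((Matrix.kroneckerMap (· * ·) (E x a) (F y b)).mulVec ψ) z)).symm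

theorem pvm_orthogonal {O A : Type} [Fintype O] [Fintype A] [DecidableEq A]
    (E : O → Matrix A A ℂ) (hE : ∀ a, (E a).IsHermitian ∧ E a * E a = E a)
    (hE1 : ∑ a, E a = 1) (a b : O) (hab : a ≠ b) : E a * E b = 0 := by
  classical
  have h0 : ∑ c, E b * E c * E b = E b := by
    rw [← Finset.sum_mul, ← Finset.mul_sum, hE1, mul_one, (hE b).2]
  rw [← Finset.add_sum_erase _ _ (Finset.mem_univ b), (hE b).2, (hE b).2] at h0
  have h1 : ∑ c ∈ Finset.univ.erase b, E b * E c * E b = 0 := by simpa using h0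
  have h2 : ∀ c, E b * E c * E b = (E c * E b)ᴴ * (E c * E b) := by
    intro c
    rw [Matrix.conjTranspose_mul, (hE c).1.eq, (hE b).1.eq, Matrix.mul_assoc, Matrix.mul_assoc,
      ← Matrix.mul_assoc (E c) (E c), (hE c).2]
  have h3 : ∑ c ∈ Finset.univ.erase b, ((E c * E b)ᴴ * (E c * E b)).trace = 0 := by
    rw [← Matrix.trace_sum, ← Finset.sum_congr rfl (fun c _ => h2 c), h1, Matrix.trace_zero]
  open scoped ComplexOrder in
  rw [Finset.sum_eq_zero_iff_of_nonneg
    (fun c _ => (Matrix.posSemidef_conjTranspose_mul_self _).trace_nonneg)] at h3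
  open scoped ComplexOrder in
  exact Matrix.trace_conjTranspose_mul_self_eq_zero_iff.1
    (h3 a (Finset.mem_erase.2 ⟨hab, Finset.mem_univ a⟩))

theorem pvm_coarse {O R A : Type} [Fintype O] [Fintype R] [Fintype A] [DecidableEq A]
    [DecidableEq R]
    (E : O → Matrix A A ℂ) (hE : ∀ a, (E a).IsHermitian ∧ E a * E a = E a)
    (hE1 : ∑ a, E a = 1) (f : O → R) :
    (∀ r, (∑ a with f a = r, E a).IsHermitian ∧
      (∑ a with f a = r, E a) * (∑ a with f a = r, E a) = ∑ a with f a = r, E a) ∧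
    ∑ r, ∑ a with f a = r, E a = 1 := by
  classical
  refine ⟨fun r => ⟨?_, ?_⟩, ?_⟩
  · rw [Matrix.IsHermitian, Matrix.conjTranspose_sum]
    exact Finset.sum_congr rfl fun a _ => (hE a).1
  · rw [Finset.sum_mul]
    refine Finset.sum_congr rfl fun a ha => ?_
    rw [Finset.mul_sum, Finset.sum_eq_single a, (hE a).2]
    · exact fun b _ hb => pvm_orthogonal E hE hE1 a b hb.symm
    · exact fun h => absurd ha h
  · rw [Finset.sum_fiberwise, hE1]

/-- Relabelling outputs. -/
theorem PerfectQ_relabel {I O R : Type} [Fintype I] [Fintype O] [Fintype R]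
    (lose : I → I → O → O → Prop) (lose' : I → I → R → R → Prop) (f : O → R)
    (h : ∀ x y a b, lose' x y (f a) (f b) → lose x y a b) (hQ : PerfectQ lose) :
    PerfectQ lose' := by
  classical
  obtain ⟨p, ⟨dA, dB, hA, hB, E, F, ψ, hE, hE1, hF, hF1, hψ, hp⟩, hl⟩ := hQ
  refine ⟨fun x y r s => ∑ a with f a = r, ∑ b with f b = s, p x y a b,
    ⟨dA, dB, hA, hB, fun x r => ∑ a with f a = r, E x a, fun x r => ∑ a with f a = r, F x a, ψ,
      fun x => (pvm_coarse (E x) (hE x) (hE1 x) f).1,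
      fun x => (pvm_coarse (E x) (hE x) (hE1 x) f).2,
      fun x => (pvm_coarse (F x) (hF x) (hF1 x) f).1,
      fun x => (pvm_coarse (F x) (hF x) (hF1 x) f).2, hψ, ?_⟩, ?_⟩
  · intro x y r s
    have hk : Matrix.kroneckerMap (· * ·) (∑ a with f a = r, E x a) (∑ b with f b = s, F y b) =
        ∑ a with f a = r, ∑ b with f b = s, Matrix.kroneckerMap (· * ·) (E x a) (F y b) := by
      ext i j
      simp [Matrix.sum_apply, Finset.sum_mul_sum]
    rw [hk]
    push_cast
    simp only [hp, Matrix.sum_mulVec, dotProduct_sum]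
  · intro x y r s hrs
    refine Finset.sum_eq_zero fun a ha => Finset.sum_eq_zero fun b hb => hl _ _ _ _ (h _ _ _ _ ?_)
    rw [(Finset.mem_filter.1 ha).2, (Finset.mem_filter.1 hb).2]
    exact hrs

theorem pvm_prod {O P A B : Type} [Fintype O] [Fintype P] [Fintype A] [DecidableEq A]
    [Fintype B] [DecidableEq B]
    (E : O → Matrix A A ℂ) (hE : ∀ a, (E a).IsHermitian ∧ E a * E a = E a)
    (hE1 : ∑ a, E a = 1) (X : O → P → Matrix B B ℂ)
    (hX : ∀ a v, (X a v).IsHermitian ∧ X a v * X a v = X a v) (hX1 : ∀ a, ∑ v, X a v = 1) :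
    (∀ z : O × P, (Matrix.kroneckerMap (· * ·) (E z.1) (X z.1 z.2)).IsHermitian ∧
      Matrix.kroneckerMap (· * ·) (E z.1) (X z.1 z.2) *
        Matrix.kroneckerMap (· * ·) (E z.1) (X z.1 z.2) =
      Matrix.kroneckerMap (· * ·) (E z.1) (X z.1 z.2)) ∧
    ∑ z : O × P, Matrix.kroneckerMap (· * ·) (E z.1) (X z.1 z.2) = 1 := by
  refine ⟨fun z => ⟨?_, ?_⟩, ?_⟩
  · rw [Matrix.IsHermitian, Matrix.conjTranspose_kronecker, (hE _).1.eq, (hX _ _).1.eq]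
  · rw [← Matrix.mul_kronecker_mul, (hE _).2, (hX _ _).2]
  · rw [Fintype.sum_prod_type]
    have : ∀ a, ∑ v, Matrix.kroneckerMap (· * ·) (E a) (X a v) =
        Matrix.kroneckerMap (· * ·) (E a) 1 := by
      intro a
      rw [← hX1 a]
      ext i j
      simp [Matrix.sum_apply, Finset.mul_sum]
    simp only [this]
    rw [← Matrix.one_kronecker_one, ← hE1]
    ext i j
    simp [Matrix.sum_apply, Finset.sum_mul]

/-- Running a second strategy on the outputs of the first one. -/
theorem PerfectQ_comp {I O J P : Type} [Fintype I] [Fintype O] [Fintype J] [Fintype P]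
    (lose₁ : I → I → O → O → Prop) (lose₂ : J → J → P → P → Prop) (e : O → J)
    (h₁ : PerfectQ lose₁) (h₂ : PerfectQ lose₂) :
    PerfectQ (fun (x y : I) (a b : O × P) =>
      lose₁ x y a.1 b.1 ∨ lose₂ (e a.1) (e b.1) a.2 b.2) := by
  obtain ⟨p, ⟨dA, dB, hA, hB, E, F, ψ, hE, hE1, hF, hF1, hψ, hp⟩, hl⟩ := h₁
  obtain ⟨q, ⟨cA, cB, hcA, hcB, X, Y, φ, hX, hX1, hY, hY1, hφ, hq⟩, hm⟩ := h₂
  have : NeZero dA := ⟨hA.ne'⟩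
  have : NeZero dB := ⟨hB.ne'⟩
  have : NeZero cA := ⟨hcA.ne'⟩
  have : NeZero cB := ⟨hcB.ne'⟩
  let σ := Equiv.prodProdProdComm (Fin dA) (Fin cA) (Fin dB) (Fin cB)
  let χ : (Fin dA × Fin dB) × (Fin cA × Fin cB) → ℂ := fun z => ψ z.1 * φ z.2
  have hE' := fun x => pvm_prod (E x) (hE x) (hE1 x) (fun a => X (e a)) (fun a => hX (e a))
    (fun a => hX1 (e a))
  have hF' := fun x => pvm_prod (F x) (hF x) (hF1 x) (fun a => Y (e a)) (fun a => hY (e a))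
    (fun a => hY1 (e a))
  refine ⟨fun x y a b => p x y a.1 b.1 * q (e a.1) (e b.1) a.2 b.2,
    QCorr_mk _ (fun x z => Matrix.kroneckerMap (· * ·) (E x z.1) (X (e z.1) z.2))
      (fun x z => Matrix.kroneckerMap (· * ·) (F x z.1) (Y (e z.1) z.2)) (χ ∘ σ)
      (fun x => (hE' x).1) (fun x => (hE' x).2) (fun x => (hF' x).1) (fun x => (hF' x).2)
      ?_ ?_, ?_⟩
  · have h := dotProduct_kron_aux (1 : Matrix _ _ ℂ) (1 : Matrix _ _ ℂ) ψ φ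
    rw [Matrix.one_kronecker_one] at h
    simp only [Matrix.one_mulVec] at h
    rw [hψ, hφ, one_mul] at h
    rw [← h]
    exact Equiv.sum_comp σ (fun z => star χ z * χ z)
  · intro x y a b
    push_cast
    rw [hp, hq, ← dotProduct_kron_aux]
    have h1 : Matrix.kroneckerMap (· * ·)
          (Matrix.kroneckerMap (· * ·) (E x a.1) (X (e a.1) a.2))
          (Matrix.kroneckerMap (· * ·) (F y b.1) (Y (e b.1) b.2)) =
        (Matrix.kroneckerMap (· * ·) (Matrix.kroneckerMap (· * ·) (E x a.1) (F y b.1))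
          (Matrix.kroneckerMap (· * ·) (X (e a.1) a.2) (Y (e b.1) b.2))).submatrix σ σ := by
      ext i j
      simp only [Matrix.kroneckerMap_apply, Matrix.submatrix_apply, σ,
        Equiv.prodProdProdComm_apply]
      ring
    rw [h1, Matrix.submatrix_mulVec_equiv, Function.comp_assoc, Equiv.self_comp_symm,
      Function.comp_id]
    exact (Equiv.sum_comp σ (fun z => star χ z *
      ((Matrix.kroneckerMap (· * ·) (Matrix.kroneckerMap (· * ·) (E x a.1) (F y b.1))
          (Matrix.kroneckerMap (· * ·) (X (e a.1) a.2) (Y (e b.1) b.2))).mulVec χ) z)).symm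
  · rintro x y a b (h | h)
    · simp only [hl _ _ _ _ h, zero_mul]
    · simp only [hm _ _ _ _ h, mul_zero]

/-- If `G ≅_q H` then `α_q(G) = α_q(H)`. -/
theorem alphaQ_eq_of_QIso {VG VH : Type} [Fintype VG] [Fintype VH]
    [Nonempty VG] [Nonempty VH] (G : SimpleGraph VG) (H : SimpleGraph VH)
    (h : QIso G H) : alphaQ G = alphaQ H := by
  have key : {c : ℕ | PerfectQ (indepLose G c)} = {c : ℕ | PerfectQ (indepLose H c)} := by
    ext c
    constructor
    · intro hc
      refine PerfectQ_relabel _ _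
        (fun z : VG × (VG ⊕ VH) => Sum.elim (fun _ => Classical.arbitrary VH) id z.2) ?_
        (PerfectQ_comp _ _ Sum.inl hc h)
      rintro x y ⟨a, v⟩ ⟨b, w⟩ hlose
      by_contra hcon
      rw [not_or] at hcon
      obtain ⟨h1, h2⟩ := hcon
      obtain ⟨gA, hA, gB, hB, e1, e2, hr⟩ := not_not.1 h2
      rcases v with v | v <;> rcases w with w | w <;> simp [pairIO] at e1 e2
      obtain ⟨rfl, rfl⟩ := e1
      obtain ⟨rfl, rfl⟩ := e2
      simp only [indepLose, relSame, Sum.elim_inr, id] at h1 hr hlose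
      have hG : a = b → ¬ G.Adj a b := fun hh hadj => G.ne_of_adj hadj hh
      have hH : v = w → ¬ H.Adj v w := fun hh hadj => H.ne_of_adj hadj hh
      clear h2 hc h
      grind
    · intro hc
      refine PerfectQ_relabel _ _
        (fun z : VH × (VG ⊕ VH) => Sum.elim id (fun _ => Classical.arbitrary VG) z.2) ?_
        (PerfectQ_comp _ _ Sum.inr hc h)
      rintro x y ⟨a, v⟩ ⟨b, w⟩ hlose
      by_contra hcon
      rw [not_or] at hcon
      obtain ⟨h1, h2⟩ := hcon
      obtain ⟨gA, hA, gB, hB, e1, e2, hr⟩ := not_not.1 h2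
      rcases v with v | v <;> rcases w with w | w <;> simp [pairIO] at e1 e2
      obtain ⟨rfl, rfl⟩ := e1
      obtain ⟨rfl, rfl⟩ := e2
      simp only [indepLose, relSame, Sum.elim_inl, id] at h1 hr hlose
      have hH : a = b → ¬ H.Adj a b := fun hh hadj => H.ne_of_adj hadj hh
      have hG : v = w → ¬ G.Adj v w := fun hh hadj => G.ne_of_adj hadj hh
      clear h2 hc h
      grind
  rw [alphaQ, alphaQ, key]
end
end

section
/- Let G and H be finite graphs, each with nonempty vertex set. If G ≅_qa H, then α_qa(G) = α_qa(H). -/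
open Matrix

noncomputable section

open scoped Kronecker in
/-- Quadratic form of a product state on a product operator, tensor factors rearranged. -/
lemma quad_prod {α α' β β' : Type} [Fintype α] [Fintype α'] [Fintype β] [Fintype β']
    (A : Matrix α α ℂ) (A' : Matrix α' α' ℂ) (B : Matrix β β ℂ) (B' : Matrix β' β' ℂ)
    (ψ : α × β → ℂ) (φ : α' × β' → ℂ) :
    star (fun z : (α × α') × (β × β') => ψ (z.1.1, z.2.1) * φ (z.1.2, z.2.2)) ⬝ᵥ
      ((A ⊗ₖ A') ⊗ₖ (B ⊗ₖ B')) *ᵥ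
        (fun z : (α × α') × (β × β') => ψ (z.1.1, z.2.1) * φ (z.1.2, z.2.2)) =
    (star ψ ⬝ᵥ (A ⊗ₖ B) *ᵥ ψ) * (star φ ⬝ᵥ (A' ⊗ₖ B') *ᵥ φ) := by
  simp only [dotProduct, mulVec]
  rw [Finset.sum_mul_sum, ← Fintype.sum_prod_type']
  refine Fintype.sum_equiv (Equiv.prodProdProdComm α α' β β') _ _ ?_
  intro z
  rw [mul_mul_mul_comm, Finset.sum_mul_sum, ← Fintype.sum_prod_type']
  refine congrArg₂ (· * ·) ?_ ?_
  · simp [Equiv.prodProdProdComm]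
  · refine Fintype.sum_equiv (Equiv.prodProdProdComm α α' β β') _ _ ?_
    intro z'
    simp only [Equiv.prodProdProdComm, kroneckerMap_apply, Equiv.coe_fn_mk]
    ring

lemma norm_tensor {α α' β β' : Type} [Fintype α] [Fintype α'] [Fintype β] [Fintype β']
    (ψ : α × β → ℂ) (φ : α' × β' → ℂ) :
    star (fun z : (α × α') × (β × β') => ψ (z.1.1, z.2.1) * φ (z.1.2, z.2.2)) ⬝ᵥ
        (fun z : (α × α') × (β × β') => ψ (z.1.1, z.2.1) * φ (z.1.2, z.2.2)) =
    (star ψ ⬝ᵥ ψ) * (star φ ⬝ᵥ φ) := by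
  simp only [dotProduct]
  rw [Finset.sum_mul_sum, ← Fintype.sum_prod_type']
  refine Fintype.sum_equiv (Equiv.prodProdProdComm α α' β β') _ _ ?_
  intro z
  simp [Equiv.prodProdProdComm]
  ring

/-- A projection valued measure. -/
def IsPVM {O α : Type} [Fintype O] [Fintype α] [DecidableEq α]
    (P : O → Matrix α α ℂ) : Prop :=
  (∀ a, (P a).IsHermitian ∧ P a * P a = P a) ∧ ∑ a, P a = 1

open scoped ComplexOrder in
lemma IsPVM.orth {O α : Type} [Fintype O] [Fintype α] [DecidableEq α]
    {P : O → Matrix α α ℂ} (hP : IsPVM P) {a b : O} (hab : a ≠ b) : P a * P b = 0 := by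
  classical
  have key : ∀ c, ((P c * P b)ᴴ * (P c * P b)) = P b * P c * P b := by
    intro c
    rw [conjTranspose_mul, (hP.1 c).1.eq, (hP.1 b).1.eq]
    rw [← mul_assoc, mul_assoc (P b) (P c) (P c), (hP.1 c).2]
  have hs : ∑ c, (P b * P c * P b) = P b := by
    rw [← Finset.sum_mul, ← Finset.mul_sum, hP.2, mul_one, (hP.1 b).2]
  have hs2 : ∑ c ∈ Finset.univ.erase b, (P b * P c * P b) = 0 := by
    have := Finset.add_sum_erase Finset.univ (fun c => P b * P c * P b) (Finset.mem_univ b)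
    simp only [hs, (hP.1 b).2] at this
    simpa using this
  have ht : ∑ c ∈ Finset.univ.erase b, ((P c * P b)ᴴ * (P c * P b)).trace = 0 := by
    rw [← trace_sum]
    simp only [key, hs2, trace_zero]
  rw [Finset.sum_eq_zero_iff_of_nonneg
    (fun c _ => (posSemidef_conjTranspose_mul_self (P c * P b)).trace_nonneg)] at ht
  exact trace_conjTranspose_mul_self_eq_zero_iff.1 (ht a (by simp [hab]))

lemma IsPVM.coarse {O O' α : Type} [Fintype O] [Fintype O'] [Fintype α] [DecidableEq α]
    [DecidableEq O'] {P : O → Matrix α α ℂ} (hP : IsPVM P) (f : O → O') :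
    IsPVM (fun c => ∑ a with f a = c, P a) := by
  classical
  refine ⟨fun c => ⟨?_, ?_⟩, ?_⟩
  · rw [IsHermitian, conjTranspose_sum]
    exact Finset.sum_congr rfl fun a _ => (hP.1 a).1.eq
  · rw [Finset.sum_mul_sum]
    refine Finset.sum_congr rfl fun a ha => ?_
    rw [Finset.sum_eq_single a (fun b _ hb => hP.orth hb.symm) (fun h => absurd ha h)]
    exact (hP.1 a).2
  · rw [← hP.2]
    exact Finset.sum_fiberwise _ _ _

open scoped Kronecker in
lemma IsPVM.kron {O O' I' α α' : Type} [Fintype O] [Fintype O'] [Fintype α] [DecidableEq α]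
    [Fintype α'] [DecidableEq α'] {P : O → Matrix α α ℂ} (hP : IsPVM P)
    {Q : I' → O' → Matrix α' α' ℂ} (hQ : ∀ x, IsPVM (Q x)) (s : O → I') :
    IsPVM (fun u : O × O' => P u.1 ⊗ₖ Q (s u.1) u.2) := by
  refine ⟨fun u => ⟨?_, ?_⟩, ?_⟩
  · rw [IsHermitian, conjTranspose_kronecker, (hP.1 _).1.eq, ((hQ _).1 _).1.eq]
  · rw [← mul_kronecker_mul, (hP.1 _).2, ((hQ _).1 _).2]
  · rw [Fintype.sum_prod_type]
    have : ∀ a, ∑ o, P a ⊗ₖ Q (s a) o = P a ⊗ₖ (1 : Matrix α' α' ℂ) := by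
      intro a
      rw [← (hQ (s a)).2]
      ext i j
      simp only [Matrix.sum_apply, kroneckerMap_apply, Finset.mul_sum]
    simp only [this]
    rw [← one_kronecker_one, ← hP.2]
    ext i j
    simp only [Matrix.sum_apply, kroneckerMap_apply, Finset.sum_mul]

lemma IsPVM.reindex {O α β : Type} [Fintype O] [Fintype α] [DecidableEq α] [Fintype β]
    [DecidableEq β] {P : O → Matrix α α ℂ} (hP : IsPVM P) (e : β ≃ α) :
    IsPVM (fun a => (P a).submatrix e e) := by
  refine ⟨fun a => ⟨(hP.1 a).1.submatrix _, ?_⟩, ?_⟩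
  · rw [submatrix_mul_equiv, (hP.1 a).2]
  · have := congrArg (fun M => M.submatrix e e) hP.2
    simp only [submatrix_one_equiv] at this
    rw [← this]
    ext i j
    simp [Matrix.sum_apply]

open scoped Kronecker in
/-- Membership in `QCorr` from arbitrary finite index types. -/
lemma mem_QCorr {I O α β : Type} [Fintype I] [Fintype O] [Fintype α] [Fintype β]
    [DecidableEq α] [DecidableEq β] [Nonempty α] [Nonempty β]
    {p : I → I → O → O → ℝ} (E : I → O → Matrix α α ℂ) (F : I → O → Matrix β β ℂ)
    (ψ : α × β → ℂ) (hE : ∀ x, IsPVM (E x)) (hF : ∀ x, IsPVM (F x))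
    (hψ : star ψ ⬝ᵥ ψ = 1)
    (hp : ∀ x y a b, (p x y a b : ℂ) = star ψ ⬝ᵥ (E x a ⊗ₖ F y b) *ᵥ ψ) :
    p ∈ QCorr I O := by
  let e := (Fintype.equivFin α).symm
  let e' := (Fintype.equivFin β).symm
  refine ⟨Fintype.card α, Fintype.card β, Fintype.card_pos, Fintype.card_pos,
    fun x a => (E x a).submatrix e e, fun x a => (F x a).submatrix e' e',
    fun z => ψ (e z.1, e' z.2), fun x => ((hE x).reindex e).1, fun x => ((hE x).reindex e).2,
    fun x => ((hF x).reindex e').1, fun x => ((hF x).reindex e').2, ?_, ?_⟩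
  · rw [← hψ]
    exact Fintype.sum_equiv (e.prodCongr e') _ _ fun z => rfl
  · intro x y a b
    rw [hp]
    symm
    refine Fintype.sum_equiv (e.prodCongr e') _ _ fun z => ?_
    refine congrArg (star (ψ (e z.1, e' z.2)) * ·) ?_
    exact Fintype.sum_equiv (e.prodCongr e') _ _ fun z => rfl

/-- Composition of correlations with post-processing. -/
def compCorr {I O I' O' C : Type} [Fintype O] [Fintype O'] [DecidableEq C]
    (s : O → I') (f : O × O' → C) (p : I → I → O → O → ℝ) (q : I' → I' → O' → O' → ℝ) :
    I → I → C → C → ℝ :=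
  fun x y c d => ∑ u with f u = c, ∑ v with f v = d,
    p x y u.1 v.1 * q (s u.1) (s v.1) u.2 v.2

open scoped Kronecker in
lemma comp_mem {I O I' O' C : Type} [Fintype I] [Fintype I'] [Fintype C]
    [Fintype O] [Fintype O'] [DecidableEq C]
    (s : O → I') (f : O × O' → C) {p : I → I → O → O → ℝ} {q : I' → I' → O' → O' → ℝ}
    (hp : p ∈ QCorr I O) (hq : q ∈ QCorr I' O') : compCorr s f p q ∈ QCorr I C := by
  obtain ⟨dA, dB, hA, hB, E, F, ψ, hE, hE1, hF, hF1, hψ, hp⟩ := hp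
  obtain ⟨dA', dB', hA', hB', E', F', φ, hE', hE1', hF', hF1', hφ, hq⟩ := hq
  have : NeZero dA := ⟨hA.ne'⟩
  have : NeZero dB := ⟨hB.ne'⟩
  have : NeZero dA' := ⟨hA'.ne'⟩
  have : NeZero dB' := ⟨hB'.ne'⟩
  have PE : ∀ x, IsPVM (E x) := fun x => ⟨hE x, hE1 x⟩
  have PF : ∀ x, IsPVM (F x) := fun x => ⟨hF x, hF1 x⟩
  have PE' : ∀ x, IsPVM (E' x) := fun x => ⟨hE' x, hE1' x⟩
  have PF' : ∀ x, IsPVM (F' x) := fun x => ⟨hF' x, hF1' x⟩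
  refine mem_QCorr _ _ _ (fun x => ((PE x).kron PE' s).coarse f)
    (fun x => ((PF x).kron PF' s).coarse f)
    ((norm_tensor ψ φ).trans (by rw [hψ, hφ, one_mul])) ?_
  intro x y c d
  have hsum : (∑ u with f u = c, E x u.1 ⊗ₖ E' (s u.1) u.2) ⊗ₖ
      (∑ v with f v = d, F y v.1 ⊗ₖ F' (s v.1) v.2) =
      ∑ u with f u = c, ∑ v with f v = d,
        (E x u.1 ⊗ₖ E' (s u.1) u.2) ⊗ₖ (F y v.1 ⊗ₖ F' (s v.1) v.2) := by
    ext i j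
    simp only [kroneckerMap_apply, Matrix.sum_apply, Finset.sum_mul_sum]
  rw [hsum]
  simp only [sum_mulVec, dotProduct_sum, quad_prod]
  simp only [compCorr, Complex.ofReal_sum, Complex.ofReal_mul, hp, hq]

lemma comp_mem_closure {I O I' O' C : Type} [Fintype I] [Fintype I'] [Fintype C]
    [Fintype O] [Fintype O'] [DecidableEq C]
    (s : O → I') (f : O × O' → C) {p : I → I → O → O → ℝ} {q : I' → I' → O' → O' → ℝ}
    (hp : p ∈ closure (QCorr I O)) (hq : q ∈ closure (QCorr I' O')) :
    compCorr s f p q ∈ closure (QCorr I C) := by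
  refine map_mem_closure₂ (f := compCorr s f) ?_ hp hq (fun a ha b hb => comp_mem s f ha hb)
  unfold Function.uncurry compCorr
  fun_prop

lemma perfect_comp {I O I' O' C : Type} [Fintype I] [Fintype I'] [Fintype C]
    [Fintype O] [Fintype O'] (s : O → I') (f : O' → C)
    {l : I → I → O → O → Prop} {l' : I' → I' → O' → O' → Prop} {m : I → I → C → C → Prop}
    (hl : PerfectQA l) (hl' : PerfectQA l')
    (hm : ∀ x y a b o o', ¬ l x y a b → ¬ l' (s a) (s b) o o' → ¬ m x y (f o) (f o')) :
    PerfectQA m := by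
  classical
  obtain ⟨p, hp, hp0⟩ := hl
  obtain ⟨q, hq, hq0⟩ := hl'
  refine ⟨compCorr s (fun u => f u.2) p q, comp_mem_closure _ _ hp hq, ?_⟩
  intro x y c d hcd
  refine Finset.sum_eq_zero fun u hu => Finset.sum_eq_zero fun v hv => ?_
  simp only [Finset.mem_filter, Finset.mem_univ, true_and] at hu hv
  subst hu hv
  by_cases h1 : l x y u.1 v.1
  · rw [hp0 _ _ _ _ h1, zero_mul]
  by_cases h2 : l' (s u.1) (s v.1) u.2 v.2
  · rw [hq0 _ _ _ _ h2, mul_zero]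
  exact absurd hcd (hm _ _ _ _ _ _ h1 h2)

lemma perfect_GH {VG VH : Type} [Fintype VG] [Fintype VH]
    [Nonempty VH] (G : SimpleGraph VG) (H : SimpleGraph VH)
    (h : QAIso G H) (c : ℕ) (hc : PerfectQA (indepLose G c)) : PerfectQA (indepLose H c) := by
  refine perfect_comp Sum.inl (Sum.elim (fun _ => Classical.arbitrary VH) id) hc h ?_
  intro x y a b o o' h1 h2
  unfold isoLose at h2
  rw [not_not] at h2
  obtain ⟨gA, hA, gB, hB, e1, e2, hr⟩ := h2
  rcases o with o | o <;> simp [pairIO] at e1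
  rcases o' with o' | o' <;> simp [pairIO] at e2
  obtain ⟨rfl, rfl⟩ := e1
  obtain ⟨rfl, rfl⟩ := e2
  have hG := G.loopless
  simp only [indepLose, relSame, Sum.elim_inr, id] at *
  have := G.irrefl (v := a)
  have := H.irrefl (v := o)
  grind

lemma perfect_HG {VG VH : Type} [Fintype VG] [Fintype VH]
    [Nonempty VG] (G : SimpleGraph VG) (H : SimpleGraph VH)
    (h : QAIso G H) (c : ℕ) (hc : PerfectQA (indepLose H c)) : PerfectQA (indepLose G c) := by
  refine perfect_comp Sum.inr (Sum.elim id (fun _ => Classical.arbitrary VG)) hc h ?_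
  intro x y a b o o' h1 h2
  unfold isoLose at h2
  rw [not_not] at h2
  obtain ⟨gA, hA, gB, hB, e1, e2, hr⟩ := h2
  rcases o with o | o <;> simp [pairIO] at e1
  rcases o' with o' | o' <;> simp [pairIO] at e2
  obtain ⟨rfl, rfl⟩ := e1
  obtain ⟨rfl, rfl⟩ := e2
  simp only [indepLose, relSame, Sum.elim_inl, id] at *
  have := H.irrefl (v := a)
  have := G.irrefl (v := o)
  grind

/-- If `G ≅_qa H` then `α_qa(G) = α_qa(H)`. -/
theorem alphaQA_eq_of_QAIso {VG VH : Type} [Fintype VG] [Fintype VH]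
    [Nonempty VG] [Nonempty VH] (G : SimpleGraph VG) (H : SimpleGraph VH)
    (h : QAIso G H) : alphaQA G = alphaQA H := by
  unfold alphaQA
  congr 1
  ext c
  exact ⟨perfect_GH G H h c, perfect_HG G H h c⟩
end
end

section
/- Let G be a finite graph with nonempty vertex set and let Ḡ denote its complement. Then α_q(G) ≤ χ_q(Ḡ). -/
open Matrix

noncomputable section

lemma aux_vec {I O : Type} [Fintype I] [Fintype O] {lose : I → I → O → O → Prop}
    (h : PerfectQ lose) (hs : ∀ x a b, a ≠ b → lose x x a b) :
    ∃ (n : ℕ × ℕ) (ψ : EuclideanSpace ℂ (Fin n.1 × Fin n.2))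
      (u : I → O → EuclideanSpace ℂ (Fin n.1 × Fin n.2)),
      inner ℂ ψ ψ = (1 : ℂ) ∧ (∀ x, ∑ a, u x a = ψ) ∧
      ∀ x y a b, lose x y a b → inner ℂ (u x a) (u y b) = (0 : ℂ) := by
  classical
  obtain ⟨p, ⟨dA, dB, -, -, E, F, ψ, hE, hE1, hF, hF1, hψ, hp⟩, hl⟩ := h
  have key : ∀ M N : Matrix (Fin dA × Fin dB) (Fin dA × Fin dB) ℂ,
      inner ℂ (WithLp.toLp 2 (M *ᵥ ψ)) (WithLp.toLp 2 (N *ᵥ ψ))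
        = star ψ ⬝ᵥ ((Mᴴ * N) *ᵥ ψ) := by
    intro M N
    rw [EuclideanSpace.inner_toLp_toLp, dotProduct_comm, star_mulVec, ← dotProduct_mulVec,
      mulVec_mulVec]
  let Ψ : EuclideanSpace ℂ (Fin dA × Fin dB) := WithLp.toLp 2 ψ
  let u : I → O → EuclideanSpace ℂ (Fin dA × Fin dB) :=
    fun x a => WithLp.toLp 2 ((kroneckerMap (· * ·) (E x a) 1) *ᵥ ψ)
  let w : I → O → EuclideanSpace ℂ (Fin dA × Fin dB) :=
    fun y b => WithLp.toLp 2 ((kroneckerMap (· * ·) 1 (F y b)) *ᵥ ψ)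
  have hΨ : Ψ = WithLp.toLp 2 ((1 : Matrix (Fin dA × Fin dB) (Fin dA × Fin dB) ℂ) *ᵥ ψ) := by
    simp [Ψ]
  have hEh : ∀ x a, (kroneckerMap (· * ·) (E x a) (1 : Matrix (Fin dB) (Fin dB) ℂ))ᴴ
      = kroneckerMap (· * ·) (E x a) 1 := by
    intro x a
    rw [conjTranspose_kronecker, (hE x a).1.eq, conjTranspose_one]
  have hFh : ∀ x a, (kroneckerMap (· * ·) (1 : Matrix (Fin dA) (Fin dA) ℂ) (F x a))ᴴ
      = kroneckerMap (· * ·) 1 (F x a) := by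
    intro x a
    rw [conjTranspose_kronecker, (hF x a).1.eq, conjTranspose_one]
  have huw : ∀ x y a b, inner ℂ (u x a) (w y b) = (p x y a b : ℂ) := by
    intro x y a b
    rw [hp]
    simp only [u, w]
    rw [key, hEh, ← mul_kronecker_mul, mul_one, one_mul]
  have huu : ∀ x a, inner ℂ (u x a) (u x a) = inner ℂ (u x a) Ψ := by
    intro x a
    rw [hΨ]
    simp only [u]
    rw [key, key, hEh, ← mul_kronecker_mul, mul_one, mul_one, (hE x a).2]
  have hww : ∀ x a, inner ℂ (w x a) (w x a) = inner ℂ Ψ (w x a) := by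
    intro x a
    rw [hΨ]
    simp only [w]
    rw [key, key, hFh, ← mul_kronecker_mul, conjTranspose_one, one_mul, one_mul, (hF x a).2]
  have hus : ∀ x, ∑ a, u x a = Ψ := by
    intro x
    simp only [u]
    rw [← WithLp.toLp_sum, ← sum_mulVec]
    have : ∑ a, kroneckerMap (· * ·) (E x a) (1 : Matrix (Fin dB) (Fin dB) ℂ) = 1 := by
      rw [← one_kronecker_one, ← hE1 x]
      ext i j
      simp [Matrix.sum_apply, Finset.sum_mul]
    rw [this, hΨ]
  have hws : ∀ x, ∑ a, w x a = Ψ := by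
    intro x
    simp only [w]
    rw [← WithLp.toLp_sum, ← sum_mulVec]
    have : ∑ a, kroneckerMap (· * ·) (1 : Matrix (Fin dA) (Fin dA) ℂ) (F x a) = 1 := by
      rw [← one_kronecker_one, ← hF1 x]
      ext i j
      simp [Matrix.sum_apply, Finset.mul_sum]
    rw [this, hΨ]
  have h0 : ∀ x y a b, lose x y a b → inner ℂ (u x a) (w y b) = (0 : ℂ) := by
    intro x y a b h
    rw [huw, hl _ _ _ _ h]; simp
  have huΨ : ∀ x a, inner ℂ (u x a) Ψ = inner ℂ (u x a) (w x a) := by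
    intro x a
    rw [← hws x, inner_sum]
    exact Finset.sum_eq_single a (fun b _ hb => h0 _ _ _ _ (hs x a b hb.symm)) (by simp)
  have hwΨ : ∀ x a, inner ℂ Ψ (w x a) = inner ℂ (u x a) (w x a) := by
    intro x a
    rw [← hus x, sum_inner]
    exact Finset.sum_eq_single a (fun b _ hb => h0 _ _ _ _ (hs x b a hb)) (by simp)
  have heq : ∀ x a, u x a = w x a := by
    intro x a
    have hc : inner ℂ (w x a) (u x a) = inner ℂ (u x a) (w x a) := by
      rw [← inner_conj_symm, ← huΨ, ← huu, inner_conj_symm]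
    rw [← sub_eq_zero, ← inner_self_eq_zero (𝕜 := ℂ), inner_sub_left, inner_sub_right,
      inner_sub_right, hc, huu, huΨ, hww, hwΨ]
    ring
  refine ⟨(dA, dB), Ψ, u, ?_, hus, ?_⟩
  · simp only [Ψ]
    rw [EuclideanSpace.inner_toLp_toLp, dotProduct_comm, hψ]
  · intro x y a b h
    rw [heq y b]
    exact h0 _ _ _ _ h

lemma aux_count {H : Type*} [NormedAddCommGroup H] [InnerProductSpace ℂ H] {c d : ℕ}
    (Ω : H) (z : Fin c → Fin d → H) (hΩ : inner ℂ Ω Ω = (1 : ℂ)) (hz : ∀ i, ∑ k, z i k = Ω)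
    (h1 : ∀ i k l, k ≠ l → inner ℂ (z i k) (z i l) = (0 : ℂ))
    (h2 : ∀ i j k, i ≠ j → inner ℂ (z i k) (z j k) = (0 : ℂ)) : c ≤ d := by
  have hzΩ : ∀ i k, inner ℂ (z i k) Ω = inner ℂ (z i k) (z i k) := by
    intro i k
    conv_lhs => rw [← hz i, inner_sum]
    exact Finset.sum_eq_single k (fun b _ hb => h1 _ _ _ hb.symm) (by simp)
  have hΩz : ∀ i k, inner ℂ Ω (z i k) = inner ℂ (z i k) (z i k) := by
    intro i k
    conv_lhs => rw [← hz i, sum_inner]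
    exact Finset.sum_eq_single k (fun b _ hb => h1 _ _ _ hb) (by simp)
  have hpos : ∀ k, (0 : ℝ) ≤ (1 - ∑ i, inner ℂ (z i k) (z i k) : ℂ).re := by
    intro k
    have h := inner_self_nonneg (𝕜 := ℂ) (x := Ω - ∑ i, z i k)
    have e : inner ℂ (Ω - ∑ i, z i k) (Ω - ∑ i, z i k)
        = (1 - ∑ i, inner ℂ (z i k) (z i k) : ℂ) := by
      have e1 : inner ℂ (∑ i, z i k) (∑ i, z i k) = (∑ i, inner ℂ (z i k) (z i k) : ℂ) := by
        rw [sum_inner]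
        refine Finset.sum_congr rfl fun i _ => ?_
        rw [inner_sum]
        exact Finset.sum_eq_single i (fun b _ hb => h2 _ _ _ hb.symm) (by simp)
      rw [inner_sub_left, inner_sub_right, inner_sub_right, hΩ, e1, sum_inner, inner_sum]
      simp only [hzΩ, hΩz]
      ring
    rw [e] at h
    exact h
  have hs : ∑ k : Fin d, (1 - ∑ i, inner ℂ (z i k) (z i k) : ℂ) = (d : ℂ) - c := by
    rw [Finset.sum_sub_distrib, Finset.sum_comm]
    have : ∀ i, ∑ k, inner ℂ (z i k) (z i k) = (1 : ℂ) := by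
      intro i
      rw [← hΩ]
      conv_rhs => rw [← hz i, sum_inner, hz i]
      exact Finset.sum_congr rfl fun k _ => (hzΩ i k).symm
    simp only [this]
    simp
  have h := Finset.sum_nonneg (s := Finset.univ) fun k _ => hpos k
  rw [← Complex.re_sum, hs] at h
  simp at h
  exact_mod_cast h

lemma aux_le {V : Type} [Fintype V] (G : SimpleGraph V) {c d : ℕ}
    (hc : PerfectQ (indepLose G c)) (hd : PerfectQ (colorLose Gᶜ d)) : c ≤ d := by
  obtain ⟨n, ψ, u, hψ, hu, hul⟩ := aux_vec hc (fun x a b h => Or.inl ⟨rfl, h⟩)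
  obtain ⟨m, φ, t, hφ, ht, htl⟩ := aux_vec hd (fun x a b h => Or.inl ⟨rfl, h⟩)
  refine aux_count (ψ ⊗ₜ[ℂ] φ) (fun i k => ∑ v, u i v ⊗ₜ[ℂ] t v k) ?_ ?_ ?_ ?_
  · rw [TensorProduct.inner_tmul, hψ, hφ, one_mul]
  · intro i
    rw [Finset.sum_comm]
    simp only [← TensorProduct.tmul_sum, ht, ← TensorProduct.sum_tmul, hu]
  · intro i k l hkl
    simp only [inner_sum, sum_inner, TensorProduct.inner_tmul]
    refine Finset.sum_eq_zero fun v _ => Finset.sum_eq_zero fun w _ => ?_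
    by_cases hvw : w = v
    · subst hvw
      rw [htl _ _ _ _ (Or.inl ⟨rfl, hkl⟩), mul_zero]
    · rw [hul _ _ _ _ (Or.inl ⟨rfl, hvw⟩), zero_mul]
  · intro i j k hij
    simp only [inner_sum, sum_inner, TensorProduct.inner_tmul]
    refine Finset.sum_eq_zero fun v _ => Finset.sum_eq_zero fun w _ => ?_
    rw [mul_eq_zero, or_iff_not_imp_left]
    intro hne
    refine htl _ _ _ _ (Or.inr ⟨?_, rfl⟩)
    rw [SimpleGraph.compl_adj]
    exact ⟨fun h => hne (hul _ _ _ _ (Or.inr ⟨hij, Or.inl h⟩)),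
      fun h => hne (hul _ _ _ _ (Or.inr ⟨hij, Or.inr h⟩))⟩

lemma aux_ne {V : Type} [Fintype V] (G : SimpleGraph V) :
    PerfectQ (colorLose G (Fintype.card V)) := by
  classical
  let e := Fintype.equivFin V
  refine ⟨fun v w i j => if i = e v ∧ j = e w then 1 else 0, ⟨1, 1, one_pos, one_pos,
    fun v i => if i = e v then 1 else 0, fun v i => if i = e v then 1 else 0,
    fun _ => 1, ?_, ?_, ?_, ?_, ?_, ?_⟩, ?_⟩
  · intro x a
    dsimp only
    split_ifs <;> simp [Matrix.isHermitian_one, Matrix.isHermitian_zero]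
  · intro x; simp
  · intro x a
    dsimp only
    split_ifs <;> simp [Matrix.isHermitian_one, Matrix.isHermitian_zero]
  · intro x; simp
  · simp [dotProduct]
  · intro x y a b
    by_cases h1 : a = e x <;> by_cases h2 : b = e y <;>
      simp [h1, h2, dotProduct, mulVec, Fintype.sum_prod_type]
  · rintro v w i j (⟨rfl, h⟩ | ⟨h, rfl⟩)
    · dsimp only
      rw [if_neg]
      rintro ⟨rfl, rfl⟩
      exact h rfl
    · dsimp only
      rw [if_neg]
      rintro ⟨h1, h2⟩
      exact h.ne (e.injective (h1.symm.trans h2))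

/-- `α_q(G) ≤ χ_q(Ḡ)`. -/
theorem alphaQ_le_chiQ_compl {V : Type} [Fintype V] [Nonempty V]
    (G : SimpleGraph V) : alphaQ G ≤ chiQ Gᶜ := by
  refine le_csInf ⟨_, aux_ne Gᶜ⟩ fun d hd => ?_
  exact csSup_le' fun c hc => aux_le G hc hd
end
end

section
/- Let G be a finite graph with nonempty vertex set and let Ḡ denote its complement. Then α_qa(G) ≤ χ_qa(Ḡ). -/
open Matrix

noncomputable section

/-- A correlation in `QCorr` is a matrix of inner products of two families of vectors whose
norms are the marginals. -/
theorem qcorr_vectors {I O : Type} [Fintype I] [Fintype O] {p : I → I → O → O → ℝ}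
    (hp : p ∈ QCorr I O) :
    ∃ (κ : Type) (_ : Fintype κ) (u w : I → O → EuclideanSpace ℂ κ),
      (∀ x y a b, p x y a b = (inner ℂ (u x a) (w y b) : ℂ).re) ∧
      (∀ x a, ‖u x a‖ ^ 2 = ∑ b, p x x a b) ∧
      (∀ x a, ‖w x a‖ ^ 2 = ∑ b, p x x b a) ∧
      (∀ x y, ∑ a, ∑ b, p x y a b = 1) := by
  obtain ⟨dA, dB, -, -, E, F, ψ, hE, hE1, hF, hF1, hψ, hpp⟩ := hp
  set e : I → O → Matrix (Fin dA × Fin dB) (Fin dA × Fin dB) ℂ :=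
    fun x a => Matrix.kroneckerMap (· * ·) (E x a) 1 with he
  set f : I → O → Matrix (Fin dA × Fin dB) (Fin dA × Fin dB) ℂ :=
    fun x a => Matrix.kroneckerMap (· * ·) 1 (F x a) with hf
  have eH : ∀ x a, (e x a)ᴴ = e x a := fun x a => by
    simp only [he, Matrix.conjTranspose_kronecker, (hE x a).1.eq, Matrix.conjTranspose_one]
  have fH : ∀ x a, (f x a)ᴴ = f x a := fun x a => by
    simp only [hf, Matrix.conjTranspose_kronecker, (hF x a).1.eq, Matrix.conjTranspose_one]
  have ee : ∀ x a, e x a * e x a = e x a := fun x a => by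
    simp only [he, ← Matrix.mul_kronecker_mul, (hE x a).2, mul_one]
  have ff : ∀ x a, f x a * f x a = f x a := fun x a => by
    simp only [hf, ← Matrix.mul_kronecker_mul, (hF x a).2, mul_one]
  have ef : ∀ x y a b, e x a * f y b = Matrix.kroneckerMap (· * ·) (E x a) (F y b) :=
    fun x y a b => by
      simp only [he, hf, ← Matrix.mul_kronecker_mul, mul_one, one_mul]
  have e1 : ∀ x, ∑ a, e x a = 1 := fun x => by
    ext ⟨i, j⟩ ⟨k, l⟩
    have h := congrFun (congrFun (hE1 x) i) k
    simp only [Matrix.sum_apply] at h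
    simp only [he, Matrix.sum_apply, Matrix.kroneckerMap_apply, ← Finset.sum_mul, h]
    simp only [Matrix.one_apply, Prod.mk.injEq]
    split_ifs <;> simp_all
  have f1 : ∀ x, ∑ a, f x a = 1 := fun x => by
    ext ⟨i, j⟩ ⟨k, l⟩
    have h := congrFun (congrFun (hF1 x) j) l
    simp only [Matrix.sum_apply] at h
    simp only [hf, Matrix.sum_apply, Matrix.kroneckerMap_apply, ← Finset.mul_sum, h]
    simp only [Matrix.one_apply, Prod.mk.injEq]
    split_ifs <;> simp_all
  have key : ∀ A B : Matrix (Fin dA × Fin dB) (Fin dA × Fin dB) ℂ, Aᴴ = A →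
      (inner ℂ (WithLp.toLp 2 (A *ᵥ ψ)) (WithLp.toLp 2 (B *ᵥ ψ)) : ℂ)
        = star ψ ⬝ᵥ ((A * B) *ᵥ ψ) := by
    intro A B hA
    rw [EuclideanSpace.inner_eq_star_dotProduct, dotProduct_comm]
    simp only [Matrix.star_mulVec, hA]
    rw [← Matrix.dotProduct_mulVec, Matrix.mulVec_mulVec]
  have pe : ∀ x y a b, (p x y a b : ℂ) = star ψ ⬝ᵥ ((e x a * f y b) *ᵥ ψ) := fun x y a b => by
    rw [ef, hpp]
  have s1 : ∀ x y a, ((∑ b, p x y a b : ℝ) : ℂ) = star ψ ⬝ᵥ (e x a *ᵥ ψ) := fun x y a => by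
    push_cast
    simp only [pe]
    rw [← dotProduct_sum, ← Matrix.sum_mulVec, ← Finset.mul_sum, f1, mul_one]
  have s2 : ∀ x y b, ((∑ a, p x y a b : ℝ) : ℂ) = star ψ ⬝ᵥ (f y b *ᵥ ψ) := fun x y b => by
    push_cast
    simp only [pe]
    rw [← dotProduct_sum, ← Matrix.sum_mulVec, ← Finset.sum_mul, e1, one_mul]
  refine ⟨Fin dA × Fin dB, inferInstance, fun x a => WithLp.toLp 2 (e x a *ᵥ ψ),
    fun x a => WithLp.toLp 2 (f x a *ᵥ ψ), ?_, ?_, ?_, ?_⟩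
  · intro x y a b
    rw [key _ _ (eH x a), ← pe, Complex.ofReal_re]
  · intro x a
    rw [← inner_self_eq_norm_sq (𝕜 := ℂ), key _ _ (eH x a), ee, ← s1 x x a]
    simp
  · intro x a
    rw [← inner_self_eq_norm_sq (𝕜 := ℂ), key _ _ (fH x a), ff, ← s2 x x a]
    simp
  · intro x y
    have : ((∑ a, ∑ b, p x y a b : ℝ) : ℂ) = 1 := by
      rw [Complex.ofReal_sum]
      simp only [s1]
      rw [← dotProduct_sum, ← Matrix.sum_mulVec, e1, Matrix.one_mulVec, hψ]
    exact_mod_cast this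

/-- A synchronous correlation in the closure of `QCorr` is a Gram matrix of real vectors. -/
theorem sync_gram {I O : Type} [Fintype I] [Fintype O] {p : I → I → O → O → ℝ}
    (hp : p ∈ closure (QCorr I O)) (hs : ∀ x a b, a ≠ b → p x x a b = 0) :
    (∃ (m : ℕ) (B : Fin m → I → O → ℝ), ∀ x y a b, p x y a b = ∑ s, B s x a * B s y b) ∧
      ∀ x y, ∑ a, ∑ b, p x y a b = 1 := by
  classical
  obtain ⟨q, hq, hlim⟩ := mem_closure_iff_seq_limit.1 hp
  have hl : ∀ x y a b, Filter.Tendsto (fun n => q n x y a b) Filter.atTop (nhds (p x y a b)) := by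
    intro x y a b
    have h1 := tendsto_pi_nhds.1 hlim x
    have h2 := tendsto_pi_nhds.1 h1 y
    have h3 := tendsto_pi_nhds.1 h2 a
    exact tendsto_pi_nhds.1 h3 b
  choose κ fκ u w h1 h2 h3 h4 using fun n => qcorr_vectors (hq n)
  have sum1 : ∀ x y, ∑ a, ∑ b, p x y a b = 1 := by
    intro x y
    have : Filter.Tendsto (fun n => ∑ a, ∑ b, q n x y a b) Filter.atTop
        (nhds (∑ a, ∑ b, p x y a b)) :=
      tendsto_finsetSum _ fun a _ => tendsto_finsetSum _ fun b _ => hl x y a b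
    simp only [h4] at this
    exact (tendsto_nhds_unique this tendsto_const_nhds)
  refine ⟨?_, sum1⟩
  -- the Gram matrices converge to `p`
  have hM : ∀ x y a b, Filter.Tendsto (fun n => (inner ℂ (u n x a) (u n y b) : ℂ).re)
      Filter.atTop (nhds (p x y a b)) := by
    intro x y a b
    have hb : ∀ n, |q n x y a b - (inner ℂ (u n x a) (u n y b) : ℂ).re| ≤
        √(∑ c, q n x x a c) *
          √(∑ c, q n y y b c - 2 * q n y y b b + ∑ c, q n y y c b) := by
      intro n
      have e1 : ‖u n x a‖ = √(∑ c, q n x x a c) := by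
        rw [← h2, Real.sqrt_sq (norm_nonneg _)]
      have e2 : ‖u n y b - w n y b‖ =
          √(∑ c, q n y y b c - 2 * q n y y b b + ∑ c, q n y y c b) := by
        rw [← h2, ← h3, h1 n y y b b]
        rw [← Real.sqrt_sq (norm_nonneg (u n y b - w n y b)), norm_sub_sq (𝕜 := ℂ)]
        rfl
      rw [← e1, ← e2, h1, ← Complex.sub_re, ← inner_sub_right, norm_sub_rev]
      exact (Complex.abs_re_le_norm _).trans (norm_inner_le_norm _ _)
    have hz : Filter.Tendsto (fun n => √(∑ c, q n x x a c) *
          √(∑ c, q n y y b c - 2 * q n y y b b + ∑ c, q n y y c b)) Filter.atTop (nhds 0) := by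
      have t1 : Filter.Tendsto (fun n => √(∑ c, q n x x a c)) Filter.atTop
          (nhds (√(∑ c, p x x a c))) :=
        (tendsto_finsetSum _ fun c _ => hl x x a c).sqrt
      have t2 : Filter.Tendsto
          (fun n => √(∑ c, q n y y b c - 2 * q n y y b b + ∑ c, q n y y c b)) Filter.atTop
          (nhds (√(∑ c, p y y b c - 2 * p y y b b + ∑ c, p y y c b))) :=
        (((tendsto_finsetSum _ fun c _ => hl y y b c).sub ((hl y y b b).const_mul 2)).add
          (tendsto_finsetSum _ fun c _ => hl y y c b)).sqrt
      have z : √(∑ c, p y y b c - 2 * p y y b b + ∑ c, p y y c b) = 0 := by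
        rw [Finset.sum_eq_single b (fun c _ hc => hs y b c (Ne.symm hc)) (by simp),
          Finset.sum_eq_single b (fun c _ hc => hs y c b hc) (by simp)]
        rw [show p y y b b - 2 * p y y b b + p y y b b = 0 by ring, Real.sqrt_zero]
      have := t1.mul t2
      rwa [z, mul_zero] at this
    have := squeeze_zero_norm
      (f := fun n => q n x y a b - (inner ℂ (u n x a) (u n y b) : ℂ).re) hb hz
    simpa using (hl x y a b).sub this
  have hpsd : (Matrix.of fun i j : I × O => p i.1 j.1 i.2 j.2).PosSemidef := by
    refine Matrix.PosSemidef.of_dotProduct_mulVec_nonneg ?_ ?_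
    · ext i j
      simp only [Matrix.conjTranspose_apply, Matrix.of_apply, star_trivial]
      refine tendsto_nhds_unique (hM j.1 i.1 j.2 i.2) ?_
      refine (hM i.1 j.1 i.2 j.2).congr fun n => ?_
      rw [← inner_conj_symm, Complex.conj_re]
    · intro c
      have t : Filter.Tendsto (fun n => ∑ i : I × O, c i * ∑ j : I × O,
          (inner ℂ (u n i.1 i.2) (u n j.1 j.2) : ℂ).re * c j) Filter.atTop
          (nhds (∑ i : I × O, c i * ∑ j : I × O, p i.1 j.1 i.2 j.2 * c j)) :=
        tendsto_finsetSum _ fun i _ => (tendsto_finsetSum _ fun j _ =>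
          (hM i.1 j.1 i.2 j.2).mul_const _).const_mul _
      have t0 := ge_of_tendsto' (b := 0) t fun n => by
        have : ∑ i : I × O, c i * ∑ j : I × O,
            (inner ℂ (u n i.1 i.2) (u n j.1 j.2) : ℂ).re * c j =
            (inner ℂ (∑ i : I × O, (c i : ℂ) • u n i.1 i.2)
              (∑ i : I × O, (c i : ℂ) • u n i.1 i.2) : ℂ).re := by
          rw [sum_inner, Complex.re_sum]
          refine Finset.sum_congr rfl fun i _ => ?_
          rw [inner_sum, Complex.re_sum, Finset.mul_sum]
          refine Finset.sum_congr rfl fun j _ => ?_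
          rw [inner_smul_left, inner_smul_right, Complex.conj_ofReal, Complex.re_ofReal_mul,
            Complex.re_ofReal_mul]
          ring
        rw [this]
        exact inner_self_nonneg (𝕜 := ℂ)
      simpa [dotProduct, Matrix.mulVec] using t0
  obtain ⟨m, v, hv⟩ := Matrix.posSemidef_iff_eq_sum_vecMulVec.1 hpsd
  refine ⟨m, fun s x a => v s (x, a), fun x y a b => ?_⟩
  have := congrFun (congrFun hv (x, a)) (y, b)
  simpa [Matrix.sum_apply, Matrix.vecMulVec_apply] using this

/-- Counting argument for `K_c → K_d`. -/
theorem count_le {S : Type} [Fintype S] {c d : ℕ} (Z : S → Fin c → Fin d → ℝ)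
    (h1 : ∀ i j, ∑ k, ∑ l, ∑ s, Z s i k * Z s j l = 1)
    (h2 : ∀ i k l, k ≠ l → ∑ s, Z s i k * Z s i l = 0)
    (h3 : ∀ i j k, i ≠ j → ∑ s, Z s i k * Z s j k = 0) : c ≤ d := by
  rcases Nat.eq_zero_or_pos c with rfl | hc
  · exact Nat.zero_le _
  let i0 : Fin c := ⟨0, hc⟩
  have hgg : ∀ i j, ∑ s, (∑ k, Z s i k) * (∑ l, Z s j l) = 1 := by
    intro i j
    rw [← h1 i j]
    simp only [Finset.sum_mul_sum]
    rw [Finset.sum_comm]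
    exact Finset.sum_congr rfl fun k _ => Finset.sum_comm
  have hg : ∀ i s, ∑ k, Z s i k = ∑ k, Z s i0 k := by
    intro i
    have h0 : ∑ s, (∑ k, Z s i k - ∑ k, Z s i0 k) ^ 2 = 0 := by
      have : ∀ s, (∑ k, Z s i k - ∑ k, Z s i0 k) ^ 2 =
          (∑ k, Z s i k) * (∑ k, Z s i k) - 2 * ((∑ k, Z s i k) * (∑ k, Z s i0 k)) +
          (∑ k, Z s i0 k) * (∑ k, Z s i0 k) := fun s => by ring
      simp only [this, Finset.sum_add_distrib, Finset.sum_sub_distrib, ← Finset.mul_sum, hgg]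
      norm_num
    intro s
    have := (Finset.sum_eq_zero_iff_of_nonneg (fun s _ => sq_nonneg _)).1 h0 s (Finset.mem_univ _)
    exact sub_eq_zero.1 (pow_eq_zero_iff two_ne_zero |>.1 this)
  have hzg : ∀ i k, ∑ s, Z s i k * ∑ l, Z s i0 l = ∑ s, Z s i k * Z s i k := by
    intro i k
    simp only [← hg i, Finset.mul_sum]
    rw [Finset.sum_comm]
    exact Finset.sum_eq_single k (fun l _ hl => h2 i k l hl.symm) (by simp)
  have hk : ∀ k, ∑ i, ∑ s, Z s i k * Z s i k ≤ 1 := by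
    intro k
    have hSS : ∑ s, (∑ i, Z s i k) * (∑ i, Z s i k) = ∑ i, ∑ s, Z s i k * Z s i k := by
      simp only [Finset.sum_mul_sum]
      rw [Finset.sum_comm]
      refine Finset.sum_congr rfl fun i _ => ?_
      rw [Finset.sum_comm]
      exact Finset.sum_eq_single i (fun j _ hj => h3 i j k hj.symm) (by simp)
    have hSg : ∑ s, (∑ i, Z s i k) * (∑ l, Z s i0 l) = ∑ i, ∑ s, Z s i k * Z s i k := by
      simp only [Finset.sum_mul (s := (Finset.univ : Finset (Fin c)))]
      rw [Finset.sum_comm]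
      exact Finset.sum_congr rfl fun i _ => hzg i k
    have hpos : 0 ≤ ∑ s, (∑ i, Z s i k - ∑ l, Z s i0 l) ^ 2 :=
      Finset.sum_nonneg fun s _ => sq_nonneg _
    have : ∀ s, (∑ i, Z s i k - ∑ l, Z s i0 l) ^ 2 =
        (∑ i, Z s i k) * (∑ i, Z s i k) - 2 * ((∑ i, Z s i k) * (∑ l, Z s i0 l)) +
        (∑ l, Z s i0 l) * (∑ l, Z s i0 l) := fun s => by ring
    simp only [this, Finset.sum_add_distrib, Finset.sum_sub_distrib, ← Finset.mul_sum, hgg,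
      hSS, hSg] at hpos
    linarith
  have hi : ∀ i, ∑ k, ∑ s, Z s i k * Z s i k = 1 := by
    intro i
    rw [← h1 i i]
    refine Finset.sum_congr rfl fun k _ => ?_
    exact (Finset.sum_eq_single k (fun l _ hl => h2 i k l hl.symm) (by simp)).symm
  have hA : (c : ℝ) = ∑ k : Fin d, ∑ i : Fin c, ∑ s, Z s i k * Z s i k := by
    rw [Finset.sum_comm]
    simp [hi]
  have hB : ∑ k : Fin d, ∑ i : Fin c, ∑ s, Z s i k * Z s i k ≤ ∑ k : Fin d, (1 : ℝ) :=
    Finset.sum_le_sum fun k _ => hk k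
  rw [← hA] at hB
  simp only [Finset.sum_const, Finset.card_univ, Fintype.card_fin, nsmul_eq_mul, mul_one] at hB
  exact_mod_cast hB

/-- Exchange two pairs of sums. -/
theorem sum_comm_four {α β γ δ : Type} [Fintype α] [Fintype β] [Fintype γ] [Fintype δ]
    (f : α → β → γ → δ → ℝ) :
    ∑ s, ∑ t, ∑ v, ∑ w, f s t v w = ∑ v, ∑ w, ∑ s, ∑ t, f s t v w := by
  have h := Finset.sum_comm (s := (Finset.univ : Finset (α × β)))
    (t := (Finset.univ : Finset (γ × δ))) (f := fun x y => f x.1 x.2 y.1 y.2)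
  simpa only [Fintype.sum_prod_type] using h

/-- The composition argument. -/
theorem indep_le_color {V : Type} [Fintype V] (G : SimpleGraph V) {c d : ℕ}
    (hc : PerfectQA (indepLose G c)) (hd : PerfectQA (colorLose Gᶜ d)) : c ≤ d := by
  obtain ⟨p, hp, hp0⟩ := hc
  obtain ⟨r, hr, hr0⟩ := hd
  have ps : ∀ i v w, v ≠ w → p i i v w = 0 := fun i v w h => hp0 _ _ _ _ (Or.inl ⟨rfl, h⟩)
  have rs : ∀ v k l, k ≠ l → r v v k l = 0 := fun i v w h => hr0 _ _ _ _ (Or.inl ⟨rfl, h⟩)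
  obtain ⟨⟨m, B, hB⟩, p1⟩ := sync_gram hp ps
  obtain ⟨⟨m', C, hC⟩, r1⟩ := sync_gram hr rs
  have hq : ∀ i j k l, ∑ s : Fin m × Fin m', (∑ v, B s.1 i v * C s.2 v k) *
      (∑ w, B s.1 j w * C s.2 w l) = ∑ v, ∑ w, p i j v w * r v w k l := by
    intro i j k l
    simp only [hB, hC, Finset.sum_mul_sum, Fintype.sum_prod_type]
    rw [sum_comm_four]
    refine Finset.sum_congr rfl fun v _ => Finset.sum_congr rfl fun w _ =>
      Finset.sum_congr rfl fun s _ => Finset.sum_congr rfl fun t _ => ?_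
    ring
  refine count_le (fun (s : Fin m × Fin m') i k => ∑ v, B s.1 i v * C s.2 v k) ?_ ?_ ?_
  · intro i j
    simp only [hq]
    calc ∑ k, ∑ l, ∑ v, ∑ w, p i j v w * r v w k l
        = ∑ v, ∑ w, ∑ k, ∑ l, p i j v w * r v w k l :=
          sum_comm_four _
      _ = 1 := by simp only [← Finset.mul_sum, r1, mul_one, p1]
  · intro i k l hkl
    rw [hq]
    refine Finset.sum_eq_zero fun v _ => Finset.sum_eq_zero fun w _ => ?_
    by_cases h : v = w
    · subst h
      rw [rs v k l hkl, mul_zero]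
    · rw [ps i v w h, zero_mul]
  · intro i j k hij
    rw [hq]
    refine Finset.sum_eq_zero fun v _ => Finset.sum_eq_zero fun w _ => ?_
    by_cases h : v = w ∨ G.Adj v w
    · rw [hp0 i j v w (Or.inr ⟨hij, h⟩), zero_mul]
    · push Not at h
      rw [hr0 v w k k (Or.inr ⟨by rw [SimpleGraph.compl_adj]; exact h, rfl⟩), mul_zero]

/-- The coloring game with `|V|` colors has a perfect strategy. -/
theorem color_exists {V : Type} [Fintype V] (G : SimpleGraph V) :
    PerfectQA (colorLose G (Fintype.card V)) := by
  classical
  let g : V ≃ Fin (Fintype.card V) := Fintype.equivFin V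
  let D : V → Fin (Fintype.card V) → Matrix (Fin 1) (Fin 1) ℂ :=
    fun v i => if g v = i then 1 else 0
  have hD : ∀ x a, (D x a).IsHermitian ∧ D x a * D x a = D x a := by
    intro x a
    simp only [D]
    split_ifs <;> simp
  refine ⟨fun v w i j => if g v = i ∧ g w = j then 1 else 0, subset_closure
    ⟨1, 1, one_pos, one_pos, D, D, fun _ => 1, hD, ?_, hD, ?_, ?_, ?_⟩, ?_⟩
  · intro x
    simp [D]
  · intro x
    simp [D]
  · simp [dotProduct]
  · intro x y a b
    simp only [D]
    by_cases h1 : g x = a <;> by_cases h2 : g y = b <;>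
      simp [h1, h2, dotProduct, Matrix.mulVec, Matrix.kroneckerMap_apply, Fintype.sum_prod_type]
  · rintro v w i j (⟨rfl, h⟩ | ⟨h, rfl⟩)
    · simp only [ite_eq_right_iff]
      rintro ⟨rfl, rfl⟩
      exact absurd rfl h
    · simp only [ite_eq_right_iff]
      rintro ⟨h1, h2⟩
      exact absurd (g.injective (h1.trans h2.symm)) h.ne

/-- `α_qa(G) ≤ χ_qa(Ḡ)`. -/
theorem alphaQA_le_chiQA_compl {V : Type} [Fintype V] [Nonempty V]
    (G : SimpleGraph V) : alphaQA G ≤ chiQA Gᶜ := by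
  have hne : {d : ℕ | PerfectQA (colorLose Gᶜ d)}.Nonempty := ⟨_, color_exists Gᶜ⟩
  have hd : PerfectQA (colorLose Gᶜ (chiQA Gᶜ)) := Nat.sInf_mem hne
  unfold alphaQA
  rcases Set.eq_empty_or_nonempty {c : ℕ | PerfectQA (indepLose G c)} with h | h
  · rw [h]
    simp
  · exact csSup_le h fun c hc => indep_le_color G hc hd
end
end
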